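/- Every 1-planar graph with minimum degree 7 contains a copy of the star K_{1,7} whose center has degree exactly 7 in G and whose seven leaves each have degree at most 23 in G; moreover at most one of the leaves has degree at least 12. -/

import Mathlib

/-- A 1-planar drawing of a simple graph in the plane: vertices at distinct
points, each edge an injective continuous arc between the images of its
endpoints, arc interiors avoiding vertices, any two arcs crossing in at most
one interior point, and every edge crossing at most one other edge. -/
structure OnePlanarDrawing {V : Type*} (G : SimpleGraph V) where
  pos : V → ℝ × ℝ
  pos_inj : Function.Injective pos
  arc : G.edgeSet → ℝ → ℝ × ℝ
  arc_cont : ∀ e, ContinuousOn (arc e) (Set.Icc 0 1)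
  arc_inj : ∀ e, Set.InjOn (arc e) (Set.Icc 0 1)
  arc_ends : ∀ e : G.edgeSet, ∃ u v : V, (e : Sym2 V) = s(u, v) ∧
      arc e 0 = pos u ∧ arc e 1 = pos v
  arc_avoids : ∀ e, ∀ t ∈ Set.Ioo (0 : ℝ) 1, arc e t ∉ Set.range pos
  crossings_subsingleton : ∀ e f : G.edgeSet, e ≠ f →
      (arc e '' Set.Ioo 0 1 ∩ arc f '' Set.Ioo 0 1).Subsingleton
  at_most_one_crossing : ∀ e : G.edgeSet,
      {f : G.edgeSet | f ≠ e ∧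
        (arc e '' Set.Ioo 0 1 ∩ arc f '' Set.Ioo 0 1).Nonempty}.Subsingleton

/-- A graph is 1-planar if it admits a drawing in the plane in which every
edge crosses at most one other edge. -/
def SimpleGraph.IsOnePlanar {V : Type*} (G : SimpleGraph V) : Prop :=
  Nonempty (OnePlanarDrawing G)

/-- The far end of a grid edge; the edge `(p, false)` is horizontal and `(p, true)` is vertical,
both starting at `p`. -/
def gridEnd (η : (ℤ × ℤ) × Bool) : ℤ × ℤ :=
  if η.2 then (η.1.1, η.1.2 + 1) else (η.1.1 + 1, η.1.2)

/-- One side of a grid edge `η`, the other being `η.1`; a unit square is named after its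
lower left corner. -/
def gridSide (η : (ℤ × ℤ) × Bool) : ℤ × ℤ :=
  if η.2 then (η.1.1 - 1, η.1.2) else (η.1.1, η.1.2 - 1)

/-- The sum of a mod 2 chain over the four grid edges at each vertex. -/
def gridBoundary : ((ℤ × ℤ) × Bool → ZMod 2) →ₗ[ZMod 2] (ℤ × ℤ → ZMod 2) where
  toFun x p := x (p, false) + x ((p.1 - 1, p.2), false) + x (p, true) + x ((p.1, p.2 - 1), true)
  map_add' x y := by ext p; simp only [Pi.add_apply]; ring
  map_smul' c x := by ext p; simp only [Pi.smul_apply, smul_eq_mul, RingHom.id_apply]; ring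

theorem ZMod.add_self_two (x : ZMod 2) : x + x = 0 := CharTwo.add_self_eq_zero x

theorem gridBoundary_apply (x : (ℤ × ℤ) × Bool → ZMod 2) (p : ℤ × ℤ) :
    gridBoundary x p =
      x (p, false) + x ((p.1 - 1, p.2), false) + x (p, true) + x ((p.1, p.2 - 1), true) := rfl

theorem gridBoundary_coboundary (g : ℤ × ℤ → ZMod 2) :
    gridBoundary (fun η => g η.1 + g (gridSide η)) = 0 := by
  ext ⟨i, j⟩
  simp only [gridBoundary_apply, gridSide, Pi.zero_apply]
  simp only [Bool.false_eq_true, if_false, if_true]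
  linear_combination ZMod.add_self_two (g (i, j)) + ZMod.add_self_two (g (i, j - 1)) +
    ZMod.add_self_two (g (i - 1, j)) + ZMod.add_self_two (g (i - 1, j - 1))

theorem gridBoundary_eq_sum (K : Finset ((ℤ × ℤ) × Bool)) (x : (ℤ × ℤ) × Bool → ZMod 2)
    (hx : ∀ η ∉ K, x η = 0) (p : ℤ × ℤ) :
    gridBoundary x p =
      ∑ η ∈ K, x η * ((if η.1 = p then 1 else 0) + if gridEnd η = p then 1 else 0) := by
  obtain ⟨i, j⟩ := p
  have key : ∀ η : (ℤ × ℤ) × Bool,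
      x η * ((if η.1 = (i, j) then 1 else 0) + if gridEnd η = (i, j) then 1 else 0) =
      (if η = ((i, j), false) then x η else 0) + (if η = ((i - 1, j), false) then x η else 0) +
      (if η = ((i, j), true) then x η else 0) + (if η = ((i, j - 1), true) then x η else 0) := by
    rintro ⟨⟨k, m⟩, β⟩
    cases β
    · have : (k + 1 = i ∧ m = j) ↔ (k = i - 1 ∧ m = j) := by omega
      simp [gridEnd, mul_add, this]
    · have : (k = i ∧ m + 1 = j) ↔ (k = i ∧ m = j - 1) := by omega
      simp [gridEnd, mul_add, this]
  simp only [key, Finset.sum_add_distrib, Finset.sum_ite_eq', gridBoundary_apply]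
  have h : ∀ η, (if η ∈ K then x η else 0) = x η := fun η => by
    split_ifs with h
    · rfl
    · exact (hx η h).symm
  simp only [h]

/-- A finitely supported mod 2 cycle of the grid is the coboundary of a function on squares. -/
theorem exists_coboundary_of_gridBoundary_eq_zero (K : Finset ((ℤ × ℤ) × Bool))
    (x : (ℤ × ℤ) × Bool → ZMod 2) (hx : ∀ η ∉ K, x η = 0) (hc : gridBoundary x = 0) :
    ∃ g : ℤ × ℤ → ZMod 2, ∀ η, x η = g η.1 + g (gridSide η) := by
  obtain ⟨N, hN⟩ : ∃ N : ℤ, ∀ η ∈ K, η.1.2 < N := by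
    obtain ⟨N, hN⟩ := (K.image fun η => η.1.2).bddAbove
    refine ⟨N + 1, fun η hη => Int.lt_add_one_of_le (hN ?_)⟩
    exact Finset.mem_coe.2 (Finset.mem_image_of_mem _ hη)
  have hx' : ∀ η, N ≤ η.1.2 → x η = 0 := fun η h => hx η fun hK => by
    have := hN η hK
    omega
  let g : ℤ × ℤ → ZMod 2 := fun p => ∑ k ∈ Finset.Ioc p.2 N, x ((p.1, k), false)
  have hg : ∀ i j, g (i, j - 1) = x ((i, j), false) + g (i, j) := by
    intro i j
    by_cases hj : j ≤ N
    · have : Finset.Ioc (j - 1) N = insert j (Finset.Ioc j N) := by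
        ext k; simp only [Finset.mem_Ioc, Finset.mem_insert]; omega
      simp only [g, this]
      rw [Finset.sum_insert (by simp)]
    · have h1 : Finset.Ioc (j - 1) N = ∅ := Finset.Ioc_eq_empty (by omega)
      have h2 : Finset.Ioc j N = ∅ := Finset.Ioc_eq_empty (by omega)
      simp only [g, h1, h2, Finset.sum_empty]
      rw [hx' _ (by simp; omega)]; simp
  have hz : ∀ i j, N ≤ j → g (i, j) = 0 := by
    intro i j h
    simp only [g]
    rw [Finset.Ioc_eq_empty (by omega), Finset.sum_empty]
  have hv : ∀ i j, x ((i, j), true) + (g (i, j) + g (i - 1, j)) = 0 := by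
    intro i j
    rcases le_total N j with h | h
    · rw [hz _ _ h, hz _ _ h, hx' _ h]; simp
    · induction j, h using Int.leInductionDown with
      | base => rw [hz _ _ le_rfl, hz _ _ le_rfl, hx' _ le_rfl]; simp
      | pred j hj ih =>
        have h1 := congrFun hc (i, j)
        simp only [gridBoundary_apply, Pi.zero_apply] at h1
        rw [hg, hg]
        linear_combination h1 + ih - ZMod.add_self_two (x ((i, j), true))
  refine ⟨g, ?_⟩
  rintro ⟨⟨i, j⟩, β⟩
  cases β
  · simp only [gridSide, Bool.false_eq_true, if_false]
    rw [hg]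
    linear_combination -ZMod.add_self_two (g (i, j))
  · simp only [gridSide, if_true]
    linear_combination hv i j - ZMod.add_self_two (g (i, j)) - ZMod.add_self_two (g (i - 1, j))

/-- A set of grid vertices is connected if every set of vertices that meets it and is closed
under adjacency inside it contains it. -/
def GridConnected (C : Set (ℤ × ℤ)) : Prop :=
  ∀ S : Set (ℤ × ℤ), (∃ p ∈ C, p ∈ S) →
    (∀ η : (ℤ × ℤ) × Bool, η.1 ∈ C → gridEnd η ∈ C → (η.1 ∈ S ↔ gridEnd η ∈ S)) → C ⊆ S

theorem gridBoundary_single (η : (ℤ × ℤ) × Bool) :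
    gridBoundary (Pi.single η 1) = Pi.single η.1 1 + Pi.single (gridEnd η) 1 := by
  ext p
  rw [gridBoundary_eq_sum {η} _ (fun θ hθ => by
    rw [Pi.single_eq_of_ne]; simpa using hθ)]
  simp [Pi.single_apply, eq_comm]

/-- On a connected set of grid vertices every function of sum zero is a boundary. -/
theorem GridConnected.exists_gridBoundary_eq {C : Finset (ℤ × ℤ)} (hC : GridConnected C)
    (c : ℤ × ℤ → ZMod 2) (hc : ∀ p ∉ C, c p = 0) (hsum : ∑ p ∈ C, c p = 0) :
    ∃ w : (ℤ × ℤ) × Bool → ZMod 2,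
      (∀ η, ¬ (η.1 ∈ C ∧ gridEnd η ∈ C) → w η = 0) ∧ gridBoundary w = c := by
  let U : Submodule (ZMod 2) ((ℤ × ℤ) × Bool → ZMod 2) :=
    { carrier := {w | ∀ η, ¬ (η.1 ∈ C ∧ gridEnd η ∈ C) → w η = 0}
      add_mem' := fun {x y} hx hy η h => by simp [hx η h, hy η h]
      zero_mem' := fun η _ => rfl
      smul_mem' := fun c x hx η h => by simp [hx η h] }
  suffices h : c ∈ U.map gridBoundary by
    obtain ⟨w, hw, h⟩ := h
    exact ⟨w, hw, h⟩
  rcases C.eq_empty_or_nonempty with rfl | ⟨p₀, hp₀⟩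
  · have : c = 0 := funext fun p => hc p (by simp)
    rw [this]; exact zero_mem _
  have hedge : ∀ η : (ℤ × ℤ) × Bool, η.1 ∈ C → gridEnd η ∈ C →
      (Pi.single η.1 1 + Pi.single (gridEnd η) 1 : ℤ × ℤ → ZMod 2) ∈ U.map gridBoundary := by
    intro η h1 h2
    refine ⟨Pi.single η 1, fun θ hθ => ?_, gridBoundary_single η⟩
    rw [Pi.single_eq_of_ne]
    rintro rfl
    exact hθ ⟨h1, h2⟩
  have hpair : ∀ p ∈ C,
      (Pi.single p₀ 1 + Pi.single p 1 : ℤ × ℤ → ZMod 2) ∈ U.map gridBoundary := by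
    suffices h : (C : Set (ℤ × ℤ)) ⊆ {p | (Pi.single p₀ 1 + Pi.single p 1 : ℤ × ℤ → ZMod 2) ∈
      U.map gridBoundary} from fun p hp => h hp
    refine hC _ ⟨p₀, hp₀, ?_⟩ ?_
    · have : (Pi.single p₀ 1 + Pi.single p₀ 1 : ℤ × ℤ → ZMod 2) = 0 :=
        funext fun q => ZMod.add_self_two _
      simp only [Set.mem_ofPred_eq, this, zero_mem]
    · intro η h1 h2
      have h3 := hedge η h1 h2
      simp only [Set.mem_ofPred_eq]
      constructor
      · intro h
        have h4 := add_mem h h3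
        convert h4 using 1
        funext q
        simp only [Pi.add_apply]
        linear_combination -ZMod.add_self_two ((Pi.single η.1 1 : ℤ × ℤ → ZMod 2) q)
      · intro h
        have h4 := add_mem h h3
        convert h4 using 1
        funext q
        simp only [Pi.add_apply]
        linear_combination -ZMod.add_self_two ((Pi.single (gridEnd η) 1 : ℤ × ℤ → ZMod 2) q)
  have hdec : c = ∑ p ∈ C, c p • (Pi.single p₀ 1 + Pi.single p 1 : ℤ × ℤ → ZMod 2) := by
    simp only [smul_add, Finset.sum_add_distrib, ← Finset.sum_smul, hsum, zero_smul, zero_add]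
    funext q
    simp only [Finset.sum_apply, Pi.smul_apply, Pi.single_apply, smul_eq_mul, mul_ite, mul_one,
      mul_zero, Finset.sum_ite_eq]
    split_ifs with h
    · rfl
    · exact hc q h
  rw [hdec]
  exact sum_mem fun p hp => Submodule.smul_mem _ _ (hpair p hp)

open Classical in
/-- Two pairs of maps, giving the ends and the sides of every edge, such that the mod 2 cycles are
exactly the coboundaries of mod 2 functions on the faces. -/
def IsAlgDual {V E F : Type*} [Fintype E] (a b : E → V) (l r : E → F) : Prop :=
  ∀ z : E → ZMod 2,
    (∀ v, ∑ e, z e * ((if a e = v then 1 else 0) + if b e = v then 1 else 0) = 0) ↔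
      ∃ g : F → ZMod 2, ∀ e, z e = g (l e) + g (r e)

open Classical in
/-- A graph that is a minor of the square grid has an algebraic dual. -/
theorem exists_isAlgDual_of_grid_minor {V E : Type*} [Fintype V] [Fintype E] (a b : E → V)
    (hab : ∀ e, a e ≠ b e) (C : V → Finset (ℤ × ℤ))
    (hdisj : ∀ u v p, p ∈ C u → p ∈ C v → u = v) (hconn : ∀ v, GridConnected (C v))
    (ε : E → (ℤ × ℤ) × Bool) (hε : Function.Injective ε)
    (hends : ∀ e, ((ε e).1 ∈ C (a e) ∧ gridEnd (ε e) ∈ C (b e)) ∨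
      ((ε e).1 ∈ C (b e) ∧ gridEnd (ε e) ∈ C (a e))) :
    ∃ (F : Type) (l r : E → F), IsAlgDual a b l r := by
  let K₀ : Finset ((ℤ × ℤ) × Bool) :=
    Finset.univ.biUnion fun v => (C v ×ˢ Finset.univ).filter fun η => gridEnd η ∈ C v
  let K : Finset ((ℤ × ℤ) × Bool) := Finset.univ.image ε ∪ K₀
  have hK₀ : ∀ η, η ∈ K₀ ↔ ∃ v, η.1 ∈ C v ∧ gridEnd η ∈ C v := fun η => by simp [K₀]
  have hεK₀ : ∀ e, ε e ∉ K₀ := by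
    intro e h
    obtain ⟨v, h1, h2⟩ := (hK₀ _).1 h
    rcases hends e with ⟨h3, h4⟩ | ⟨h3, h4⟩
    · exact hab e ((hdisj _ _ _ h3 h1).trans (hdisj _ _ _ h2 h4))
    · exact hab e ((hdisj _ _ _ h4 h2).trans (hdisj _ _ _ h1 h3))
  have hdisjK : Disjoint (Finset.univ.image ε) K₀ := by
    rw [Finset.disjoint_left]
    intro η hη
    obtain ⟨e, -, rfl⟩ := Finset.mem_image.1 hη
    exact hεK₀ e
  have hmem : ∀ {p u} v, p ∈ C u → (p ∈ C v ↔ u = v) := fun {p u} v h =>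
    ⟨fun h' => hdisj _ _ _ h h', fun h' => h' ▸ h⟩
  have hsum : ∀ (z : E → ZMod 2) (x : (ℤ × ℤ) × Bool → ZMod 2), (∀ η ∉ K, x η = 0) →
      (∀ e, x (ε e) = z e) → ∀ v, ∑ p ∈ C v, gridBoundary x p =
        ∑ e, z e * ((if a e = v then 1 else 0) + if b e = v then 1 else 0) := by
    intro z x hx hz v
    have h1 : ∑ p ∈ C v, gridBoundary x p = ∑ η ∈ K,
        x η * ((if η.1 ∈ C v then 1 else 0) + if gridEnd η ∈ C v then 1 else 0) := by
      rw [Finset.sum_congr rfl fun p _ => gridBoundary_eq_sum K x hx p, Finset.sum_comm]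
      refine Finset.sum_congr rfl fun η _ => ?_
      rw [← Finset.mul_sum, Finset.sum_add_distrib, Finset.sum_ite_eq, Finset.sum_ite_eq]
    rw [h1, Finset.sum_union hdisjK, Finset.sum_image hε.injOn]
    rw [Finset.sum_eq_zero (s := K₀), add_zero]
    · refine Finset.sum_congr rfl fun e _ => ?_
      rw [hz]
      rcases hends e with ⟨h3, h4⟩ | ⟨h3, h4⟩
      · simp only [hmem v h3, hmem v h4]
      · simp only [hmem v h3, hmem v h4, add_comm]
    · intro η hη
      obtain ⟨u, h3, h4⟩ := (hK₀ _).1 hη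
      simp only [hmem v h3, hmem v h4, ZMod.add_self_two, mul_zero]
  let R : ℤ × ℤ → ℤ × ℤ → Prop := fun p q => ∃ η ∉ K, p = η.1 ∧ q = gridSide η
  refine ⟨Quot R, fun e => Quot.mk R (ε e).1, fun e => Quot.mk R (gridSide (ε e)), fun z => ?_⟩
  constructor
  · intro hz
    let x₀ : (ℤ × ℤ) × Bool → ZMod 2 := fun η => ∑ e, if ε e = η then z e else 0
    have hx₀ : ∀ e, x₀ (ε e) = z e := fun e => by
      simp only [x₀, hε.eq_iff, Finset.sum_ite_eq', Finset.mem_univ, if_true]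
    have hx₀' : ∀ η, η ∉ Finset.univ.image ε → x₀ η = 0 := by
      intro η hη
      refine Finset.sum_eq_zero fun e _ => if_neg ?_
      rintro rfl
      exact hη (Finset.mem_image_of_mem _ (Finset.mem_univ e))
    have hx₀K : ∀ η ∉ K, x₀ η = 0 := fun η hη => hx₀' η fun h =>
      hη (Finset.mem_union_left _ h)
    have hc₀ : ∀ v, ∑ p ∈ C v, gridBoundary x₀ p = 0 := fun v => by
      rw [hsum z x₀ hx₀K hx₀, hz]
    have hw : ∀ v, ∃ w : (ℤ × ℤ) × Bool → ZMod 2,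
        (∀ η, ¬ (η.1 ∈ C v ∧ gridEnd η ∈ C v) → w η = 0) ∧
        gridBoundary w = fun p => if p ∈ C v then gridBoundary x₀ p else 0 := by
      intro v
      refine (hconn v).exists_gridBoundary_eq _ (fun p hp => if_neg hp) ?_
      rw [← hc₀ v]
      exact Finset.sum_congr rfl fun p hp => if_pos hp
    choose w hw hwb using hw
    have hwε : ∀ v e, w v (ε e) = 0 := fun v e => hw v _ fun h => hεK₀ e ((hK₀ _).2 ⟨v, h⟩)
    have hxK : ∀ η ∉ K, (x₀ + ∑ v, w v) η = 0 := by
      intro η hη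
      rw [Pi.add_apply, hx₀K η hη, zero_add, Finset.sum_apply]
      refine Finset.sum_eq_zero fun v _ => hw v η fun h => hη ?_
      exact Finset.mem_union_right _ ((hK₀ _).2 ⟨v, h⟩)
    obtain ⟨g, hg⟩ := exists_coboundary_of_gridBoundary_eq_zero K (x₀ + ∑ v, w v) hxK (by
      rw [map_add, map_sum]
      funext p
      simp only [hwb, Pi.add_apply, Finset.sum_apply, Pi.zero_apply]
      by_cases hp : ∃ u, p ∈ C u
      · obtain ⟨u, hu⟩ := hp
        simp only [hmem _ hu, Finset.sum_ite_eq, Finset.mem_univ, if_true, ZMod.add_self_two]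
      · push Not at hp
        simp only [hp, if_false, Finset.sum_const_zero, add_zero]
        rw [gridBoundary_eq_sum _ _ hx₀']
        refine Finset.sum_eq_zero fun η hη => ?_
        obtain ⟨e, -, rfl⟩ := Finset.mem_image.1 hη
        have h1 : (ε e).1 ≠ p := by
          rintro rfl
          rcases hends e with ⟨h, -⟩ | ⟨h, -⟩ <;> exact hp _ h
        have h2 : gridEnd (ε e) ≠ p := by
          rintro rfl
          rcases hends e with ⟨-, h⟩ | ⟨-, h⟩ <;> exact hp _ h
        rw [if_neg h1, if_neg h2, add_zero, mul_zero])
    refine ⟨Quot.lift g ?_, fun e => ?_⟩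
    · rintro _ _ ⟨η, hη, rfl, rfl⟩
      have := hg η
      rw [hxK η hη] at this
      exact CharTwo.add_eq_zero.1 this.symm
    · rw [← hg, Pi.add_apply, hx₀, Finset.sum_apply, Finset.sum_eq_zero fun v _ => hwε v e,
        add_zero]
  · rintro ⟨g, hg⟩ v
    rw [← hsum z (fun η => g (Quot.mk R η.1) + g (Quot.mk R (gridSide η))) ?_ fun e => (hg e).symm]
    · rw [gridBoundary_coboundary fun p => g (Quot.mk R p)]
      simp
    · intro η hη
      rw [show Quot.mk R η.1 = Quot.mk R (gridSide η) from Quot.sound ⟨η, hη, rfl, rfl⟩]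
      exact ZMod.add_self_two _

/-- The closed grid square of side `δ` with lower left corner `δ c`. -/
def gridSquare (δ : ℝ) (c : ℤ × ℤ) : Set (ℝ × ℝ) :=
  Set.Icc (c.1 * δ) ((c.1 + 1) * δ) ×ˢ Set.Icc (c.2 * δ) ((c.2 + 1) * δ)

/-- The grid squares of side `δ` that meet `K`. -/
def cells (δ : ℝ) (K : Set (ℝ × ℝ)) : Set (ℤ × ℤ) := {c | (K ∩ gridSquare δ c).Nonempty}

theorem mem_cells {δ : ℝ} {K : Set (ℝ × ℝ)} {c : ℤ × ℤ} :
    c ∈ cells δ K ↔ ∃ p ∈ K, p ∈ gridSquare δ c := Iff.rfl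

theorem mem_gridSquare {δ : ℝ} {c : ℤ × ℤ} {p : ℝ × ℝ} :
    p ∈ gridSquare δ c ↔ (c.1 * δ ≤ p.1 ∧ p.1 ≤ (c.1 + 1) * δ) ∧
      (c.2 * δ ≤ p.2 ∧ p.2 ≤ (c.2 + 1) * δ) := Iff.rfl

theorem exists_mem_gridSquare {δ : ℝ} (hδ : 0 < δ) (p : ℝ × ℝ) : ∃ c, p ∈ gridSquare δ c := by
  refine ⟨(⌊p.1 / δ⌋, ⌊p.2 / δ⌋), mem_gridSquare.2 ⟨⟨?_, ?_⟩, ?_, ?_⟩⟩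
  · exact (le_div_iff₀ hδ).1 (Int.floor_le _)
  · exact (div_le_iff₀ hδ).1 (Int.lt_floor_add_one _).le
  · exact (le_div_iff₀ hδ).1 (Int.floor_le _)
  · exact (div_le_iff₀ hδ).1 (Int.lt_floor_add_one _).le

theorem finite_cells {δ : ℝ} (hδ : 0 < δ) {K : Set (ℝ × ℝ)} (hK : IsCompact K) :
    (cells δ K).Finite := by
  obtain ⟨R, hR⟩ := hK.isBounded.exists_norm_le
  have key : ∀ (k : ℤ) (x : ℝ), |x| ≤ R → k * δ ≤ x → x ≤ (k + 1) * δ →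
      k ∈ Set.Icc ⌊-R / δ - 1⌋ ⌈R / δ⌉ := by
    intro k x hx h1 h2
    rw [abs_le] at hx
    constructor
    · have : -R / δ - 1 ≤ k := by
        rw [sub_le_iff_le_add, div_le_iff₀ hδ]; linarith
      exact_mod_cast (Int.floor_le _).trans this
    · have : (k : ℝ) ≤ R / δ := by
        rw [le_div_iff₀ hδ]; linarith
      exact_mod_cast this.trans (Int.le_ceil _)
  refine ((Set.finite_Icc ⌊-R / δ - 1⌋ ⌈R / δ⌉).prod
    (Set.finite_Icc ⌊-R / δ - 1⌋ ⌈R / δ⌉)).subset ?_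
  intro c hc
  obtain ⟨p, hp, hpc⟩ := mem_cells.1 hc
  obtain ⟨⟨h1, h2⟩, h3, h4⟩ := mem_gridSquare.1 hpc
  exact ⟨key _ _ ((norm_fst_le p).trans (hR p hp)) h1 h2,
    key _ _ ((norm_snd_le p).trans (hR p hp)) h3 h4⟩

theorem abs_sub_le_one_of_mul_le {δ : ℝ} (hδ : 0 < δ) {k m : ℤ} {x : ℝ} (hk : k * δ ≤ x)
    (hm : x ≤ (m + 1) * δ) : k ≤ m + 1 := by
  have : (k : ℝ) ≤ m + 1 := le_of_mul_le_mul_right (hk.trans hm) hδ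
  exact_mod_cast this

/-- The squares of a fine grid that meet a connected compact set form a connected set. -/
theorem gridConnected_cells {δ : ℝ} (hδ : 0 < δ) {K : Set (ℝ × ℝ)} (hK : IsCompact K)
    (hconn : IsPreconnected K) : GridConnected (cells δ K) := by
  intro S ⟨c₀, hc₀, hc₀S⟩ hS c hc
  by_contra hcS
  have hfin := finite_cells hδ hK
  have hclosed : ∀ T : Set (ℤ × ℤ), IsClosed (⋃ d ∈ cells δ K ∩ T, gridSquare δ d) := fun T =>
    (hfin.subset Set.inter_subset_left).isClosed_biUnion fun d _ =>
      isClosed_Icc.prod isClosed_Icc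
  have hcover : K ⊆ (⋃ d ∈ cells δ K ∩ S, gridSquare δ d) ∪
      ⋃ d ∈ cells δ K ∩ Sᶜ, gridSquare δ d := by
    intro p hp
    obtain ⟨d, hd⟩ := exists_mem_gridSquare hδ p
    have hdK : d ∈ cells δ K := mem_cells.2 ⟨p, hp, hd⟩
    by_cases h : d ∈ S
    · exact Or.inl (Set.mem_biUnion ⟨hdK, h⟩ hd)
    · exact Or.inr (Set.mem_biUnion ⟨hdK, h⟩ hd)
  obtain ⟨p₀, hp₀, hp₀c⟩ := mem_cells.1 hc₀
  obtain ⟨p₁, hp₁, hp₁c⟩ := mem_cells.1 hc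
  obtain ⟨p, hp, h1, h2⟩ := isPreconnected_closed_iff.1 hconn _ _ (hclosed S) (hclosed Sᶜ) hcover
    ⟨p₀, hp₀, Set.mem_biUnion ⟨hc₀, hc₀S⟩ hp₀c⟩ ⟨p₁, hp₁, Set.mem_biUnion ⟨hc, hcS⟩ hp₁c⟩
  simp only [Set.mem_iUnion, exists_prop] at h1 h2
  obtain ⟨⟨i, j⟩, ⟨-, hdS⟩, hd⟩ := h1
  obtain ⟨⟨i', j'⟩, ⟨-, hd'S⟩, hd'⟩ := h2
  apply hd'S
  obtain ⟨⟨a1, a2⟩, a3, a4⟩ := mem_gridSquare.1 hd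
  obtain ⟨⟨b1, b2⟩, b3, b4⟩ := mem_gridSquare.1 hd'
  simp only at a1 a2 a3 a4 b1 b2 b3 b4
  have hcell : ∀ k m : ℤ, k * δ ≤ p.1 → p.1 ≤ (k + 1) * δ → m * δ ≤ p.2 → p.2 ≤ (m + 1) * δ →
      (k, m) ∈ cells δ K := fun k m h1 h2 h3 h4 =>
    mem_cells.2 ⟨p, hp, mem_gridSquare.2 ⟨⟨h1, h2⟩, h3, h4⟩⟩
  have hmid : (i', j) ∈ S := by
    have h1 := abs_sub_le_one_of_mul_le hδ a1 b2
    have h2 := abs_sub_le_one_of_mul_le hδ b1 a2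
    rcases (by omega : i' = i ∨ i' = i + 1 ∨ i = i' + 1) with h | h | h
    · rwa [h]
    · have := hS ((i, j), false)
      simp only [gridEnd, Bool.false_eq_true, if_false, ← h] at this
      exact (this (hcell _ _ a1 a2 a3 a4) (hcell _ _ b1 b2 a3 a4)).1 hdS
    · have := hS ((i', j), false)
      simp only [gridEnd, Bool.false_eq_true, if_false, ← h] at this
      exact (this (hcell _ _ b1 b2 a3 a4) (hcell _ _ a1 a2 a3 a4)).2 hdS
  have h1 := abs_sub_le_one_of_mul_le hδ a3 b4
  have h2 := abs_sub_le_one_of_mul_le hδ b3 a4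
  rcases (by omega : j' = j ∨ j' = j + 1 ∨ j = j' + 1) with h | h | h
  · rwa [h]
  · have := hS ((i', j), true)
    simp only [gridEnd, if_true, ← h] at this
    exact (this (hcell _ _ b1 b2 a3 a4) (hcell _ _ b1 b2 b3 b4)).1 hmid
  · have := hS ((i', j'), true)
    simp only [gridEnd, if_true, ← h] at this
    exact (this (hcell _ _ b1 b2 b3 b4) (hcell _ _ b1 b2 a3 a4)).2 hmid

open Filter Topology in
theorem eventually_disjoint_cells {K L : Set (ℝ × ℝ)} (hK : IsCompact K) (hL : IsCompact L)
    (h : Disjoint K L) : ∀ᶠ δ in 𝓝[>] (0 : ℝ), ∀ c ∈ cells δ K, c ∉ cells δ L := by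
  obtain ⟨δ₀, hδ₀, hd⟩ := h.exists_thickenings hK hL.isClosed
  filter_upwards [Ioo_mem_nhdsGT hδ₀] with δ hδ c hcK hcL
  obtain ⟨p, hp, hpc⟩ := mem_cells.1 hcK
  obtain ⟨q, hq, hqc⟩ := mem_cells.1 hcL
  obtain ⟨⟨a1, a2⟩, a3, a4⟩ := mem_gridSquare.1 hpc
  obtain ⟨⟨b1, b2⟩, b3, b4⟩ := mem_gridSquare.1 hqc
  refine Set.disjoint_left.1 hd (Metric.self_subset_thickening hδ₀ K hp)
    (Metric.mem_thickening_iff.2 ⟨q, hq, lt_of_le_of_lt ?_ hδ.2⟩)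
  rw [Prod.dist_eq]
  refine max_le ?_ ?_ <;> rw [Real.dist_eq, abs_le] <;> constructor <;> linarith

/-- The vertices of `M \ D` that can be reached from `A` inside `M \ D`. -/
inductive GridReach (A M D : Set (ℤ × ℤ)) : ℤ × ℤ → Prop
  | base {p} : p ∈ A → p ∈ M → p ∉ D → GridReach A M D p
  | fwd {η} : GridReach A M D η.1 → gridEnd η ∈ M → gridEnd η ∉ D → GridReach A M D (gridEnd η)
  | bwd {η} : GridReach A M D (gridEnd η) → η.1 ∈ M → η.1 ∉ D → GridReach A M D η.1

theorem GridReach.mem_diff {A M D : Set (ℤ × ℤ)} {p : ℤ × ℤ} (h : GridReach A M D p) :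
    p ∈ M ∧ p ∉ D := by
  cases h <;> exact ⟨‹_›, ‹_›⟩

theorem exists_edge_of_gridReach {A M D : Set (ℤ × ℤ)} (hM : GridConnected M)
    (hA : ∃ p ∈ A, p ∈ M ∧ p ∉ D) (hD : ∃ p ∈ D, p ∈ M) :
    ∃ η : (ℤ × ℤ) × Bool, η.1 ∈ M ∧ gridEnd η ∈ M ∧
      ((GridReach A M D η.1 ∧ gridEnd η ∈ D) ∨ (η.1 ∈ D ∧ GridReach A M D (gridEnd η))) := by
  by_contra! hno
  obtain ⟨p, hpA, hpM, hpD⟩ := hA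
  obtain ⟨q, hqD, hqM⟩ := hD
  have : M ⊆ Set.ofPred (GridReach A M D) := by
    refine hM _ ⟨p, hpM, .base hpA hpM hpD⟩ fun η h1 h2 => ⟨fun h => ?_, fun h => ?_⟩
    · exact GridReach.fwd h h2 ((hno η h1 h2).1 h)
    · exact GridReach.bwd h h1 fun hD => (hno η h1 h2).2 hD h
  exact (GridReach.mem_diff (this hqM)).2 hqD

theorem GridConnected.union_gridReach {ι : Type*} {A : Set (ℤ × ℤ)} (hA : GridConnected A)
    (M D : ι → Set (ℤ × ℤ)) : GridConnected (A ∪ {p | ∃ i, GridReach A (M i) (D i) p}) := by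
  intro S ⟨p, hp, hpS⟩ hS
  have spread : ∀ T : Set (ℤ × ℤ), A ⊆ T →
      (∀ η : (ℤ × ℤ) × Bool, η.1 ∈ A ∪ {p | ∃ i, GridReach A (M i) (D i) p} →
        gridEnd η ∈ A ∪ {p | ∃ i, GridReach A (M i) (D i) p} → (η.1 ∈ T ↔ gridEnd η ∈ T)) →
      A ∪ {p | ∃ i, GridReach A (M i) (D i) p} ⊆ T := by
    rintro T hAT hT q (hq | ⟨i, hq⟩)
    · exact hAT hq
    · induction hq with
      | base h _ _ => exact hAT h
      | fwd h h1 h2 ih => exact (hT _ (Or.inr ⟨i, h⟩) (Or.inr ⟨i, .fwd h h1 h2⟩)).1 ih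
      | bwd h h1 h2 ih => exact (hT _ (Or.inr ⟨i, .bwd h h1 h2⟩) (Or.inr ⟨i, h⟩)).2 ih
  by_cases h : ∃ q ∈ A, q ∈ S
  · exact spread S (hA S h fun η h1 h2 => hS η (Or.inl h1) (Or.inl h2)) hS
  · push Not at h
    exact absurd hpS (spread Sᶜ h (fun η h1 h2 => not_congr (hS η h1 h2)) hp)

open Filter Topology in
/-- A graph drawn with pairwise disjoint compact connected sets `B v` as vertices and pairwise
disjoint compact connected sets `M e` as edges, where `M e` meets `B v` exactly when `v` is an end
of `e`, has an algebraic dual. -/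
theorem exists_isAlgDual_of_drawing {V E : Type*} [Fintype V] [Fintype E] (a b : E → V)
    (hab : ∀ e, a e ≠ b e) (B : V → Set (ℝ × ℝ)) (M : E → Set (ℝ × ℝ))
    (hBc : ∀ v, IsCompact (B v)) (hBp : ∀ v, IsPreconnected (B v))
    (hMc : ∀ e, IsCompact (M e)) (hMp : ∀ e, IsPreconnected (M e))
    (hBB : ∀ u v, u ≠ v → Disjoint (B u) (B v)) (hMM : ∀ e f, e ≠ f → Disjoint (M e) (M f))
    (hMB : ∀ e v, v ≠ a e → v ≠ b e → Disjoint (M e) (B v))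
    (ha : ∀ e, (M e ∩ B (a e)).Nonempty) (hb : ∀ e, (M e ∩ B (b e)).Nonempty) :
    ∃ (F : Type) (l r : E → F), IsAlgDual a b l r := by
  classical
  obtain ⟨δ, hδ, hBB, hMM, hMB⟩ : ∃ δ : ℝ, 0 < δ ∧
      (∀ u v, u ≠ v → ∀ c ∈ cells δ (B u), c ∉ cells δ (B v)) ∧
      (∀ e f, e ≠ f → ∀ c ∈ cells δ (M e), c ∉ cells δ (M f)) ∧
      (∀ e v, v ≠ a e → v ≠ b e → ∀ c ∈ cells δ (M e), c ∉ cells δ (B v)) := by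
    have h1 : ∀ᶠ δ in 𝓝[>] (0 : ℝ), 0 < δ := self_mem_nhdsWithin
    have h2 : ∀ᶠ δ in 𝓝[>] (0 : ℝ), ∀ u v, u ≠ v → ∀ c ∈ cells δ (B u), c ∉ cells δ (B v) := by
      simp only [eventually_all]
      exact fun u v h => eventually_disjoint_cells (hBc u) (hBc v) (hBB u v h)
    have h3 : ∀ᶠ δ in 𝓝[>] (0 : ℝ), ∀ e f, e ≠ f → ∀ c ∈ cells δ (M e), c ∉ cells δ (M f) := by
      simp only [eventually_all]
      exact fun u v h => eventually_disjoint_cells (hMc u) (hMc v) (hMM u v h)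
    have h4 : ∀ᶠ δ in 𝓝[>] (0 : ℝ), ∀ e v, v ≠ a e → v ≠ b e →
        ∀ c ∈ cells δ (M e), c ∉ cells δ (B v) := by
      simp only [eventually_all]
      exact fun u v h h' => eventually_disjoint_cells (hMc u) (hBc v) (hMB u v h h')
    exact (h1.and (h2.and (h3.and h4))).exists
  have hcell : ∀ {K L : Set (ℝ × ℝ)}, (K ∩ L).Nonempty → ∃ c, c ∈ cells δ K ∧ c ∈ cells δ L := by
    rintro K L ⟨p, hK, hL⟩
    obtain ⟨c, hc⟩ := exists_mem_gridSquare hδ p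
    exact ⟨c, ⟨p, hK, hc⟩, ⟨p, hL, hc⟩⟩
  let reach : E → Set (ℤ × ℤ) := fun e =>
    Set.ofPred (GridReach (cells δ (B (a e))) (cells δ (M e)) (cells δ (B (b e))))
  have hreach : ∀ e p, p ∈ reach e → p ∈ cells δ (M e) ∧ p ∉ cells δ (B (b e)) :=
    fun e p h => GridReach.mem_diff h
  let C' : V → Set (ℤ × ℤ) := fun v => cells δ (B v) ∪ {p | ∃ e, a e = v ∧ p ∈ reach e}
  have hC'eq : ∀ v, C' v = cells δ (B v) ∪ {p | ∃ e : {e // a e = v},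
      GridReach (cells δ (B v)) (cells δ (M e)) (cells δ (B (b e))) p} := by
    intro v
    ext p
    refine or_congr Iff.rfl ⟨?_, ?_⟩
    · rintro ⟨e, rfl, h⟩
      exact ⟨⟨e, rfl⟩, h⟩
    · rintro ⟨⟨e, rfl⟩, h⟩
      exact ⟨e, rfl, h⟩
  have hC'conn : ∀ v, GridConnected (C' v) := fun v => by
    rw [hC'eq]
    exact (gridConnected_cells hδ (hBc v) (hBp v)).union_gridReach _ _
  have hC'fin : ∀ v, (C' v).Finite := by
    intro v
    refine ((finite_cells hδ (hBc v)).union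
      (Set.finite_iUnion fun e => finite_cells hδ (hMc e))).subset ?_
    rintro p (h | ⟨e, -, h⟩)
    · exact Or.inl h
    · exact Or.inr (Set.mem_iUnion.2 ⟨e, (hreach e p h).1⟩)
  have hedge : ∀ e, ∃ η : (ℤ × ℤ) × Bool, η.1 ∈ cells δ (M e) ∧ gridEnd η ∈ cells δ (M e) ∧
      ((η.1 ∈ reach e ∧ gridEnd η ∈ cells δ (B (b e))) ∨
        (η.1 ∈ cells δ (B (b e)) ∧ gridEnd η ∈ reach e)) := by
    intro e
    refine exists_edge_of_gridReach (gridConnected_cells hδ (hMc e) (hMp e)) ?_ ?_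
    · obtain ⟨c, h1, h2⟩ := hcell (ha e)
      exact ⟨c, h2, h1, hBB _ _ (hab e) c h2⟩
    · obtain ⟨c, h1, h2⟩ := hcell (hb e)
      exact ⟨c, h2, h1⟩
  choose ε hε1 hε2 hε using hedge
  have hBreach : ∀ u e p, p ∈ cells δ (B u) → p ∈ reach e → a e = u := by
    intro u e p h1 h2
    by_contra h
    by_cases h' : u = b e
    · exact (hreach e p h2).2 (h' ▸ h1)
    · exact hMB e u (Ne.symm h) h' p (hreach e p h2).1 h1
  refine exists_isAlgDual_of_grid_minor a b hab (fun v => (hC'fin v).toFinset) ?_ ?_ ε ?_ ?_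
  · intro u v p hu hv
    simp only [Set.Finite.mem_toFinset] at hu hv
    by_contra huv
    rcases hu with hu | ⟨e, rfl, hu⟩ <;> rcases hv with hv | ⟨f, rfl, hv⟩
    · exact hBB u v huv p hu hv
    · exact huv (hBreach u f p hu hv).symm
    · exact huv (hBreach v e p hv hu)
    · have hef : e ≠ f := by rintro rfl; exact huv rfl
      exact hMM e f hef p (hreach e p hu).1 (hreach f p hv).1
  · intro v
    rw [Set.Finite.coe_toFinset]
    exact hC'conn v
  · intro e f hef
    by_contra h
    exact hMM e f h _ (hε1 e) (hef ▸ hε1 f)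
  · intro e
    simp only [Set.Finite.mem_toFinset]
    rcases hε e with ⟨h1, h2⟩ | ⟨h1, h2⟩
    · exact Or.inl ⟨Or.inr ⟨e, rfl, h1⟩, Or.inl h2⟩
    · exact Or.inr ⟨Or.inl h1, Or.inr ⟨e, rfl, h2⟩⟩

open Classical in
/-- The faces that differ from the opposite face along some edge. -/
noncomputable def dualFaces {E F : Type*} [Fintype E] (l r : E → F) : Finset F :=
  (Finset.univ.filter fun e => l e ≠ r e).image l ∪ (Finset.univ.filter fun e => l e ≠ r e).image r

open Classical in
/-- The edges having `f` on exactly one side. -/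
noncomputable def faceBoundary {E F : Type*} [Fintype E] (l r : E → F) (f : F) : Finset E :=
  Finset.univ.filter fun e => l e ≠ r e ∧ (l e = f ∨ r e = f)

section
variable {V E F : Type*} [Fintype E] {a b : E → V} {l r : E → F}

theorem mem_dualFaces {f : F} :
    f ∈ dualFaces l r ↔ ∃ e, l e ≠ r e ∧ (l e = f ∨ r e = f) := by
  classical
  simp only [dualFaces, Finset.mem_union, Finset.mem_image, Finset.mem_filter, Finset.mem_univ,
    true_and, ← exists_or, and_or_left]

theorem mem_faceBoundary {f : F} {e : E} :
    e ∈ faceBoundary l r f ↔ l e ≠ r e ∧ (l e = f ∨ r e = f) := by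
  simp [faceBoundary]

/-- The Euler inequality for a graph with an algebraic dual. -/
theorem IsAlgDual.card_add_two_le [Fintype V] [Nonempty V] (h : IsAlgDual a b l r)
    (hcard : Fintype.card V ≤ Fintype.card E) :
    Fintype.card E + 2 ≤ Fintype.card V + (dualFaces l r).card := by
  classical
  let D : (E → ZMod 2) →ₗ[ZMod 2] (V → ZMod 2) :=
    { toFun := fun z v => ∑ e, z e * ((if a e = v then 1 else 0) + if b e = v then 1 else 0)
      map_add' := fun x y => by
        funext v
        simp only [Pi.add_apply, add_mul, Finset.sum_add_distrib]
      map_smul' := fun c x => by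
        funext v
        simp only [Pi.smul_apply, smul_eq_mul, mul_assoc, RingHom.id_apply, Finset.mul_sum] }
  have hD : ∀ z v, D z v =
      ∑ e, z e * ((if a e = v then 1 else 0) + if b e = v then 1 else 0) := fun _ _ => rfl
  let s : (V → ZMod 2) →ₗ[ZMod 2] ZMod 2 :=
    { toFun := fun c => ∑ v, c v
      map_add' := fun x y => by simp only [Pi.add_apply, Finset.sum_add_distrib]
      map_smul' := fun c x => by
        simp only [Pi.smul_apply, smul_eq_mul, RingHom.id_apply, Finset.mul_sum] }
  have hs : ∀ c, s c = ∑ v, c v := fun _ => rfl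
  have hsD : LinearMap.range D ≤ LinearMap.ker s := by
    rintro _ ⟨z, rfl⟩
    rw [LinearMap.mem_ker, hs]
    simp only [hD]
    rw [Finset.sum_comm]
    refine Finset.sum_eq_zero fun e _ => ?_
    rw [← Finset.mul_sum, Finset.sum_add_distrib, Finset.sum_ite_eq, Finset.sum_ite_eq]
    simp [ZMod.add_self_two]
  have hssurj : Function.Surjective s := by
    intro c
    refine ⟨Pi.single (Classical.arbitrary V) c, ?_⟩
    rw [hs]; simp
  have h1 := LinearMap.finrank_range_add_finrank_ker s
  rw [LinearMap.range_eq_top.2 hssurj, finrank_top, Module.finrank_self,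
    Module.finrank_fintype_fun_eq_card] at h1
  have h2 := LinearMap.finrank_range_add_finrank_ker D
  rw [Module.finrank_fintype_fun_eq_card] at h2
  have h3 := Submodule.finrank_mono hsD
  let ext : (dualFaces l r → ZMod 2) → F → ZMod 2 := fun g f => if hf : f ∈ dualFaces l r
    then g ⟨f, hf⟩ else 0
  let δ : (dualFaces l r → ZMod 2) →ₗ[ZMod 2] (E → ZMod 2) :=
    { toFun := fun g e => ext g (l e) + ext g (r e)
      map_add' := fun x y => by
        funext e
        simp only [ext, Pi.add_apply]
        split_ifs <;> ring
      map_smul' := fun c x => by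
        funext e
        simp only [ext, Pi.smul_apply, smul_eq_mul, RingHom.id_apply]
        split_ifs <;> ring }
  have hδ : ∀ g e, δ g e = ext g (l e) + ext g (r e) := fun _ _ => rfl
  have hmem : ∀ e, l e ≠ r e → l e ∈ dualFaces l r ∧ r e ∈ dualFaces l r := fun e he =>
    ⟨mem_dualFaces.2 ⟨e, he, Or.inl rfl⟩, mem_dualFaces.2 ⟨e, he, Or.inr rfl⟩⟩
  have hker : LinearMap.ker D ≤ LinearMap.range δ := by
    intro z hz
    obtain ⟨g, hg⟩ := (h z).1 fun v => congrFun hz v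
    refine ⟨fun f => g f, funext fun e => ?_⟩
    rw [hδ, hg]
    by_cases he : l e = r e
    · rw [he, ZMod.add_self_two, ZMod.add_self_two]
    · simp only [ext, hmem e he, dif_pos]
  have h4 := Submodule.finrank_mono hker
  have h5 := LinearMap.finrank_range_add_finrank_ker δ
  rw [Module.finrank_fintype_fun_eq_card, Fintype.card_coe] at h5
  rcases (dualFaces l r).eq_empty_or_nonempty with h0 | ⟨f, hf⟩
  · have := Finset.card_eq_zero.2 h0
    omega
  · have hone : (fun _ => 1 : dualFaces l r → ZMod 2) ∈ LinearMap.ker δ := by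
      rw [LinearMap.mem_ker]
      funext e
      rw [hδ]
      by_cases he : l e = r e
      · rw [he, ZMod.add_self_two]; rfl
      · simp only [ext, hmem e he, dif_pos, ZMod.add_self_two, Pi.zero_apply]
    have h6 : 0 < Module.finrank (ZMod 2) (LinearMap.ker δ) := by
      rw [Module.finrank_pos_iff_exists_ne_zero]
      refine ⟨⟨_, hone⟩, fun h => ?_⟩
      have := congrFun (congrArg Subtype.val h) ⟨f, hf⟩
      exact one_ne_zero this
    omega

theorem IsAlgDual.even_card_faceBoundary (h : IsAlgDual a b l r) (hloop : ∀ e, a e ≠ b e)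
    (f : F) (v : V) {_ : DecidablePred fun e => a e = v ∨ b e = v} :
    Even ((faceBoundary l r f).filter fun e => a e = v ∨ b e = v).card := by
  classical
  have h1 := (h fun e => (if l e = f then 1 else 0) + if r e = f then 1 else 0).2
    ⟨fun f' => if f' = f then 1 else 0, fun e => rfl⟩ v
  have h2 : (((faceBoundary l r f).filter fun e => a e = v ∨ b e = v).card : ZMod 2) = 0 := by
    rw [← h1, faceBoundary, Finset.filter_filter, ← Finset.sum_boole]
    refine Finset.sum_congr rfl fun e _ => ?_
    have hv : (if a e = v then 1 else 0) + (if b e = v then 1 else 0) =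
        (if a e = v ∨ b e = v then 1 else 0 : ZMod 2) := by
      by_cases h1 : a e = v
      · have h2 : b e ≠ v := fun h2 => hloop e (h1.trans h2.symm)
        simp [h1, h2]
      · simp [h1]
    have hf : (if l e = f then 1 else 0) + (if r e = f then 1 else 0) =
        (if l e ≠ r e ∧ (l e = f ∨ r e = f) then 1 else 0 : ZMod 2) := by
      by_cases h1 : l e = f <;> by_cases h2 : r e = f
      · simp [h1, h2, ZMod.add_self_two]
      · have h3 : f ≠ r e := fun h3 => h2 h3.symm
        simp [h1, h2, h3]
      · simp [h1, h2]
      · simp [h1, h2]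
    rw [hv, hf, mul_ite, mul_one, mul_zero, ← ite_and]
    exact if_congr and_comm rfl rfl
  exact (ZMod.natCast_eq_zero_iff_even).1 h2

open Classical in
theorem sum_card_faceBoundary_inter_le (S : Finset E) :
    ∑ f ∈ dualFaces l r, ((faceBoundary l r f).filter (· ∈ S)).card ≤ 2 * S.card := by
  have : ∀ f, ((faceBoundary l r f).filter (· ∈ S)).card =
      ∑ e ∈ S, if e ∈ faceBoundary l r f then 1 else 0 := by
    intro f
    rw [← Finset.card_filter]
    congr 1
    ext e
    simp [and_comm]
  simp only [this]
  rw [Finset.sum_comm, mul_comm]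
  refine Finset.sum_le_card_nsmul _ _ _ fun e _ => ?_
  rw [← Finset.card_filter]
  refine (Finset.card_le_card (t := {l e, r e}) fun f hf => ?_).trans Finset.card_le_two
  have := mem_faceBoundary.1 (Finset.mem_filter.1 hf).2
  simp only [Finset.mem_insert, Finset.mem_singleton]
  tauto

end

theorem exists_ne_of_even_card {E : Type*} {S : Finset E} {P : E → Prop} {_ : DecidablePred P}
    (h : Even (S.filter P).card) {e : E} (he : e ∈ S) (heP : P e) :
    ∃ e' ∈ S, P e' ∧ e' ≠ e := by
  have he' : e ∈ S.filter P := Finset.mem_filter.2 ⟨he, heP⟩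
  have h1 : 1 < (S.filter P).card := by
    have := Finset.card_pos.2 ⟨e, he'⟩
    rcases h with ⟨k, hk⟩
    omega
  obtain ⟨e', h2, h3⟩ := Finset.exists_mem_ne h1 e
  exact ⟨e', (Finset.mem_filter.1 h2).1, (Finset.mem_filter.1 h2).2, h3⟩

section
variable {V X E F : Type*} [Fintype E]
  {a : E → V} {b : E → V ⊕ X} {l r : E → F}

theorem IsAlgDual.three_le_card_faceBoundary (h : IsAlgDual (fun e => Sum.inl (a e)) b l r)
    (hloop : ∀ e, b e ≠ Sum.inl (a e)) (hs1 : ∀ e f, e ≠ f → a e = a f → b e ≠ b f)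
    (hs2 : ∀ e f, e ≠ f → b e = Sum.inl (a f) → b f ≠ Sum.inl (a e))
    {f : F} (hf : f ∈ dualFaces l r) : 3 ≤ (faceBoundary l r f).card := by
  classical
  obtain ⟨e, he⟩ := mem_dualFaces.1 hf
  rw [← mem_faceBoundary] at he
  have hev : ∀ w, Even (((faceBoundary l r f).filter fun e => Sum.inl (a e) = w ∨ b e = w).card) :=
    fun w => h.even_card_faceBoundary (fun e => (hloop e).symm) f w
  obtain ⟨e₁, h1, h1', h1e⟩ := exists_ne_of_even_card (hev (b e)) he (Or.inr rfl)
  obtain ⟨e₂, h2, h2', h2e⟩ := exists_ne_of_even_card (hev (Sum.inl (a e))) he (Or.inl rfl)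
  have h12 : e₁ ≠ e₂ := by
    rintro rfl
    rcases h1' with h1' | h1' <;> rcases h2' with h2' | h2'
    · exact hloop e (h1'.symm.trans h2')
    · exact hs2 e e₁ h1e.symm h1'.symm h2'
    · exact hs1 e e₁ h1e.symm (Sum.inl_injective h2').symm h1'.symm
    · exact hloop e (h1'.symm.trans h2')
  exact Finset.two_lt_card.2 ⟨e, he, e₁, h1, e₂, h2, h1e.symm, h2e.symm, h12⟩

open Classical in
/-- In a graph with an algebraic dual whose vertices are split into two classes, the second one
independent, a triangular face meeting the second class has at each vertex of the first class
no more boundary edges to the second class than to the first, and at least two in total. -/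
theorem IsAlgDual.triangle_count (h : IsAlgDual (fun e => Sum.inl (a e)) b l r)
    (hloop : ∀ e, b e ≠ Sum.inl (a e)) (hs1 : ∀ e f, e ≠ f → a e = a f → b e ≠ b f)
    {f : F} (h3 : (faceBoundary l r f).card = 3)
    (hk : ((faceBoundary l r f).filter fun e => (b e).isRight).card ≠ 0) :
    2 ≤ ((faceBoundary l r f).filter fun e => (b e).isRight).card ∧
    ∀ v, ((faceBoundary l r f).filter fun e => (b e).isRight ∧ a e = v).card ≤
      ((faceBoundary l r f).filter fun e => (b e).isLeft ∧ (a e = v ∨ b e = Sum.inl v)).card := by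
  obtain ⟨e, he⟩ := Finset.card_ne_zero.1 hk
  obtain ⟨he, hex⟩ := Finset.mem_filter.1 he
  obtain ⟨x, hx⟩ := Sum.isRight_iff.1 hex
  have hev : ∀ w, Even (((faceBoundary l r f).filter fun e => Sum.inl (a e) = w ∨ b e = w).card) :=
    fun w => h.even_card_faceBoundary (fun e => (hloop e).symm) f w
  obtain ⟨e₁, he1, he1x, hne⟩ := exists_ne_of_even_card (hev (Sum.inr x)) he (Or.inr hx)
  have hx1 : b e₁ = Sum.inr x := by simpa using he1x
  have ha : a e ≠ a e₁ := fun h => hs1 e e₁ hne.symm h (hx.trans hx1.symm)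
  refine ⟨Finset.one_lt_card.2 ⟨e, ?_, e₁, ?_, hne.symm⟩, fun v => ?_⟩
  · simp [he, hx]
  · simp [he1, hx1]
  have honly : ∀ e₂ ∈ faceBoundary l r f, (b e₂).isRight → e₂ = e ∨ e₂ = e₁ := by
    intro e₂ he2 h2
    by_contra! hcon
    have hset : faceBoundary l r f = {e, e₁, e₂} := by
      refine (Finset.eq_of_subset_of_card_le ?_ ?_).symm
      · simp [Finset.insert_subset_iff, he, he1, he2]
      · rw [h3, Finset.card_eq_three.2 ⟨e, e₁, e₂, hne.symm, hcon.1.symm, hcon.2.symm, rfl⟩]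
    obtain ⟨y, hy⟩ := Sum.isRight_iff.1 h2
    by_cases hxy : x = y
    · subst hxy
      have := hev (Sum.inr x)
      rw [Finset.filter_true_of_mem, h3] at this
      · exact absurd this (by decide)
      · rw [hset]
        simp [hx, hx1, hy]
    · obtain ⟨e₃, he3, he3y, hne3⟩ := exists_ne_of_even_card (hev (Sum.inr y)) he2 (Or.inr hy)
      rw [hset] at he3
      simp only [Finset.mem_insert, Finset.mem_singleton] at he3
      rcases he3 with rfl | rfl | rfl
      · simp [hx, hxy] at he3y
      · simp [hx1, hxy] at he3y
      · exact hne3 rfl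
  have hp : ((faceBoundary l r f).filter fun e => (b e).isRight ∧ a e = v).card ≤ 1 := by
    rw [Finset.card_le_one]
    intro e₂ h2 e₃ h4
    rw [Finset.mem_filter] at h2 h4
    have hav := h2.2.2.trans h4.2.2.symm
    rcases honly e₂ h2.1 h2.2.1 with rfl | rfl <;> rcases honly e₃ h4.1 h4.2.1 with rfl | rfl
    · rfl
    · exact absurd hav ha
    · exact absurd hav ha.symm
    · rfl
  have hpq : Even (((faceBoundary l r f).filter fun e => (b e).isRight ∧ a e = v).card +
      ((faceBoundary l r f).filter
        fun e => (b e).isLeft ∧ (a e = v ∨ b e = Sum.inl v)).card) := by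
    convert hev (Sum.inl v) using 1
    rw [← Finset.card_union_of_disjoint, ← Finset.filter_or]
    · congr 1
      refine Finset.filter_congr fun e _ => ?_
      rcases b e with w | w <;> simp
    · rw [Finset.disjoint_filter]
      intro e _ h1 h2
      rcases hb : b e with w | w <;> simp [hb] at h1 h2
  rcases hpq with ⟨k, hk⟩
  omega

open Classical in
/-- The number of edges at `v` to the second class. -/
noncomputable def rightDegree (a : E → V) (b : E → V ⊕ X) (v : V) : ℕ :=
  (Finset.univ.filter fun e => (b e).isRight ∧ a e = v).card

open Classical in
/-- The number of edges at `v` to the first class. -/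
noncomputable def leftDegree (a : E → V) (b : E → V ⊕ X) (v : V) : ℕ :=
  (Finset.univ.filter fun e => (b e).isLeft ∧ (a e = v ∨ b e = Sum.inl v)).card

/-- The edge bound for a simple graph with an algebraic dual whose vertices are split into two
classes, the second one independent, with a correction for vertices of odd degree. -/
theorem IsAlgDual.edge_bound [Fintype V] [Fintype X] [Nonempty V]
    (h : IsAlgDual (fun e => Sum.inl (a e)) b l r)
    (hloop : ∀ e, b e ≠ Sum.inl (a e)) (hs1 : ∀ e f, e ≠ f → a e = a f → b e ≠ b f)
    (hs2 : ∀ e f, e ≠ f → b e = Sum.inl (a f) → b f ≠ Sum.inl (a e))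
    (hcard : Fintype.card V + Fintype.card X ≤ Fintype.card E) :
    12 * Fintype.card E + 48 + ∑ v, (leftDegree a b v + rightDegree a b v) % 2 ≤
      24 * (Fintype.card V + Fintype.card X) +
        3 * ∑ v, (leftDegree a b v + rightDegree a b v) := by
  classical
  let p : F → V → ℕ := fun f v =>
    ((faceBoundary l r f).filter fun e => (b e).isRight ∧ a e = v).card
  let q : F → V → ℕ := fun f v =>
    ((faceBoundary l r f).filter fun e => (b e).isLeft ∧ (a e = v ∨ b e = Sum.inl v)).card
  let k : F → ℕ := fun f => ((faceBoundary l r f).filter fun e => (b e).isRight).card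
  let m : F → ℕ := fun f => ((faceBoundary l r f).filter fun e => (b e).isLeft).card
  have hp : ∀ f, ∑ v, p f v = k f := by
    intro f
    simp only [p, k, ← Finset.filter_filter]
    exact Finset.sum_card_fiberwise_eq_card_filter _ _ _ |>.trans (by simp)
  have hkm : ∀ f, k f + m f = (faceBoundary l r f).card := by
    intro f
    rw [← Finset.card_filter_add_card_filter_not (s := faceBoundary l r f)
      (fun e => (b e).isRight = true)]
    simp only [Sum.not_isRight, k, m]
  have hq : ∀ f, ∑ v, q f v = 2 * m f := by
    intro f
    have hqv : ∀ v, q f v = ∑ e ∈ (faceBoundary l r f).filter (fun e => (b e).isLeft),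
        if a e = v ∨ b e = Sum.inl v then 1 else 0 := by
      intro v
      simp only [q, ← Finset.filter_filter]
      exact Finset.card_filter _ _
    rw [Finset.sum_congr rfl fun v _ => hqv v, Finset.sum_comm, mul_comm, ← smul_eq_mul, ← Finset.sum_const]
    refine Finset.sum_congr rfl fun e he => ?_
    obtain ⟨w, hw⟩ := Sum.isLeft_iff.1 (Finset.mem_filter.1 he).2
    have hne : a e ≠ w := fun h' => hloop e (by rw [hw, h'])
    rw [← Finset.card_filter, Finset.card_eq_two]
    refine ⟨a e, w, hne, ?_⟩
    ext u
    simp [hw, eq_comm]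
  let Q : F → V → ℕ := fun f v => if (faceBoundary l r f).card = 3 ∧ k f = 0 then q f v else 0
  let A : F → V → ℕ := fun f v => if (faceBoundary l r f).card = 3 ∧ k f ≠ 0 then p f v else 0
  have hAp : ∀ f v, A f v ≤ p f v := by
    intro f v
    simp only [A]
    split_ifs <;> simp
  have hAQ : ∀ f v, A f v + Q f v ≤ q f v := by
    intro f v
    simp only [A, Q]
    by_cases h3 : (faceBoundary l r f).card = 3
    · by_cases hk : k f = 0
      · simp [h3, hk]
      · simpa [h3, hk] using (h.triangle_count hloop hs1 h3 hk).2 v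
    · simp [h3]
  have hface : ∀ f ∈ dualFaces l r,
      24 ≤ 6 * (faceBoundary l r f).card + (∑ v, Q f v + 3 * ∑ v, A f v) := by
    intro f hf
    have h3 := h.three_le_card_faceBoundary hloop hs1 hs2 hf
    have h4 := hkm f
    by_cases h3' : (faceBoundary l r f).card = 3
    · by_cases hk : k f = 0
      · have hQf : ∑ v, Q f v = 2 * m f := by
          rw [← hq]
          exact Finset.sum_congr rfl fun v _ => if_pos ⟨h3', hk⟩
        omega
      · have := (h.triangle_count hloop hs1 h3' hk).1
        have h2 : 2 ≤ k f := this
        have hAf : ∑ v, A f v = k f := by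
          rw [← hp]
          exact Finset.sum_congr rfl fun v _ => if_pos ⟨h3', hk⟩
        omega
    · omega
  have hP : ∀ v, ∑ f ∈ dualFaces l r, p f v ≤ 2 * rightDegree a b v := by
    intro v
    convert sum_card_faceBoundary_inter_le (l := l) (r := r)
      (Finset.univ.filter fun e => (b e).isRight ∧ a e = v) using 5
    · simp
    · simp [rightDegree]
  have hQ : ∀ v, ∑ f ∈ dualFaces l r, q f v ≤ 2 * leftDegree a b v := by
    intro v
    convert sum_card_faceBoundary_inter_le (l := l) (r := r)
      (Finset.univ.filter fun e => (b e).isLeft ∧ (a e = v ∨ b e = Sum.inl v)) using 5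
    · simp
    · simp [leftDegree]
  have hB : ∑ f ∈ dualFaces l r, (faceBoundary l r f).card ≤ 2 * Fintype.card E := by
    convert sum_card_faceBoundary_inter_le (l := l) (r := r) (Finset.univ : Finset E) using 3
    · simp
    · simp
  have hvert : ∀ v, (leftDegree a b v + rightDegree a b v) % 2 +
      ∑ f ∈ dualFaces l r, (Q f v + 3 * A f v) ≤
        3 * (leftDegree a b v + rightDegree a b v) := by
    intro v
    have h1 := (Finset.sum_le_sum fun f _ => hAp f v).trans (hP v)
    have h2 := (Finset.sum_le_sum fun f _ => hAQ f v).trans (hQ v)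
    rw [Finset.sum_add_distrib] at h2 ⊢
    rw [← Finset.mul_sum]
    omega
  have hvert' := Finset.sum_le_sum fun v (_ : v ∈ Finset.univ) => hvert v
  have hface' := Finset.sum_le_sum hface
  rw [Finset.sum_add_distrib, ← Finset.mul_sum, Finset.sum_comm] at hvert'
  simp only [Finset.sum_const, smul_eq_mul, Finset.sum_add_distrib, ← Finset.mul_sum]
    at hface' hvert'
  have heuler := h.card_add_two_le (by rwa [Fintype.card_sum])
  rw [Fintype.card_sum] at heuler
  rw [Finset.sum_add_distrib] at *
  omega

end

/-- The first end of an edge of the planarization: an uncrossed edge keeps its source, and each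
half of a crossed edge starts at the end of the edge it contains. -/
def planarSrc {V E : Type*} {C : E → Prop} (src tgt : E → V) :
    {e // ¬ C e} ⊕ {e // C e} × Bool → V
  | Sum.inl e => src e
  | Sum.inr (e, false) => src e
  | Sum.inr (e, true) => tgt e

/-- The second end of an edge of the planarization: an uncrossed edge keeps its target, and both
halves of a crossed edge end at its crossing. -/
def planarTgt {V E X : Type*} {C : E → Prop} (tgt : E → V) (xp : {e // C e} → X) :
    {e // ¬ C e} ⊕ {e // C e} × Bool → V ⊕ X
  | Sum.inl e => Sum.inl (tgt e)
  | Sum.inr (e, _) => Sum.inr (xp e)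

section
variable {V E X : Type*} {C : E → Prop}

/-- The part of an arc that is contracted to the vertex `w` of the planarization. -/
def vertexPiece (src tgt : E → V) (t₁ t₂ t₃ t₄ : E → ℝ) (xp : {e // C e} → X) (e : E) :
    V ⊕ X → ℝ → Prop
  | Sum.inl v, s => (src e = v ∧ s ∈ Set.Icc 0 (t₁ e)) ∨ (tgt e = v ∧ s ∈ Set.Icc (t₄ e) 1)
  | Sum.inr x, s => ∃ h : C e, xp ⟨e, h⟩ = x ∧ s ∈ Set.Icc (t₂ e) (t₃ e)

/-- The underlying edge of an edge of the planarization. -/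
def planarEdge : {e // ¬ C e} ⊕ {e // C e} × Bool → E
  | Sum.inl e => e
  | Sum.inr (e, _) => e

/-- The part of an arc that represents an edge of the planarization. -/
def edgePiece (t₁ t₂ t₃ t₄ : E → ℝ) : {e // ¬ C e} ⊕ {e // C e} × Bool → Set ℝ
  | Sum.inl e => Set.Icc (t₁ e) (t₄ e)
  | Sum.inr (e, false) => Set.Icc (t₁ e) (t₂ e)
  | Sum.inr (e, true) => Set.Icc (t₃ e) (t₄ e)

/-- A system of arcs that meet only near common ends, or in pairs at the points with parameter
`c`, gives an algebraic dual of the planarization. -/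
theorem exists_isAlgDual_of_arcs [Fintype V] [Fintype E] [Fintype X] [DecidablePred C]
    (src tgt : E → V) (arc : E → ℝ → ℝ × ℝ)
    (hc : ∀ e, ContinuousOn (arc e) (Set.Icc 0 1)) (hi : ∀ e, Set.InjOn (arc e) (Set.Icc 0 1))
    (pos : V → ℝ × ℝ) (h₀ : ∀ e, arc e 0 = pos (src e)) (h₁ : ∀ e, arc e 1 = pos (tgt e))
    (hloop : ∀ e, src e ≠ tgt e)
    (t₁ t₂ c t₃ t₄ : E → ℝ) (ht₀ : ∀ e, 0 < t₁ e) (ht₁ : ∀ e, t₁ e < t₂ e)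
    (ht₂ : ∀ e, t₂ e < c e) (ht₃ : ∀ e, c e < t₃ e) (ht₄ : ∀ e, t₃ e < t₄ e) (ht₅ : ∀ e, t₄ e < 1)
    (xp : {e // C e} → X) (p : X → ℝ × ℝ) (hp : ∀ e, arc e.1 (c e.1) = p (xp e))
    (hmeet : ∀ e f, e ≠ f → ∀ s ∈ Set.Icc (0 : ℝ) 1, ∀ t ∈ Set.Icc (0 : ℝ) 1, arc e s = arc f t →
      (∃ v, ((src e = v ∧ s < t₁ e) ∨ (tgt e = v ∧ t₄ e < s)) ∧
        ((src f = v ∧ t < t₁ f) ∨ (tgt f = v ∧ t₄ f < t))) ∨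
      ∃ (he : C e) (hf : C f), s = c e ∧ t = c f ∧ xp ⟨e, he⟩ = xp ⟨f, hf⟩) :
    ∃ (F : Type) (l r : {e // ¬ C e} ⊕ {e // C e} × Bool → F),
      IsAlgDual (fun i => Sum.inl (planarSrc src tgt i)) (planarTgt tgt xp) l r := by
  have hI : ∀ e w s, vertexPiece src tgt t₁ t₂ t₃ t₄ xp e w s → s ∈ Set.Icc (0 : ℝ) 1 := by
    intro e w s h
    have := ht₀ e; have := ht₁ e; have := ht₂ e; have := ht₃ e; have := ht₄ e; have := ht₅ e
    rcases w with v | x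
    · rcases h with ⟨-, h, h'⟩ | ⟨-, h, h'⟩ <;> constructor <;> linarith
    · obtain ⟨-, -, h, h'⟩ := h
      constructor <;> linarith
  have hJ : ∀ i s, s ∈ edgePiece (C := C) t₁ t₂ t₃ t₄ i →
      s ∈ Set.Icc (t₁ (planarEdge i)) (t₄ (planarEdge i)) := by
    intro i s h
    rcases i with e | ⟨e, _ | _⟩ <;>
    · have := ht₁ e; have := ht₂ e; have := ht₃ e; have := ht₄ e
      obtain ⟨h, h'⟩ := h
      simp only [planarEdge]
      constructor <;> linarith
  have hJI : ∀ i s, s ∈ edgePiece (C := C) t₁ t₂ t₃ t₄ i → s ∈ Set.Icc (0 : ℝ) 1 := fun i s h =>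
    ⟨(ht₀ _).le.trans (hJ i s h).1, (hJ i s h).2.trans (ht₅ _).le⟩
  have hzone : ∀ e v s w, ((src e = v ∧ s < t₁ e) ∨ (tgt e = v ∧ t₄ e < s)) →
      vertexPiece src tgt t₁ t₂ t₃ t₄ xp e w s → w = Sum.inl v := by
    intro e v s w hz hw
    have := ht₁ e; have := ht₂ e; have := ht₃ e; have := ht₄ e
    rcases hz with ⟨rfl, hz⟩ | ⟨rfl, hz⟩ <;> rcases w with w | x
    · rcases hw with ⟨rfl, h, h'⟩ | ⟨-, h, h'⟩
      · rfl
      · linarith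
    · obtain ⟨-, -, h, h'⟩ := hw
      linarith
    · rcases hw with ⟨-, h, h'⟩ | ⟨rfl, h, h'⟩
      · linarith
      · rfl
    · obtain ⟨-, -, h, h'⟩ := hw
      linarith
  have hcen : ∀ e w (he : C e), vertexPiece src tgt t₁ t₂ t₃ t₄ xp e w (c e) →
      w = Sum.inr (xp ⟨e, he⟩) := by
    intro e w he hw
    have := ht₁ e; have := ht₂ e; have := ht₃ e; have := ht₄ e
    rcases w with w | x
    · rcases hw with ⟨-, h, h'⟩ | ⟨-, h, h'⟩ <;> linarith
    · obtain ⟨_, rfl, -⟩ := hw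
      rfl
  have hcen' : ∀ i, C (planarEdge i) → c (planarEdge i) ∉ edgePiece (C := C) t₁ t₂ t₃ t₄ i := by
    intro i hi h
    rcases i with e | ⟨e, _ | _⟩
    · exact e.2 hi
    · have := ht₂ e
      have h' : c e ≤ t₂ e := h.2
      linarith
    · have := ht₃ e
      have h' : t₃ e ≤ c e := h.1
      linarith
  have hnz : ∀ i s f t, s ∈ edgePiece (C := C) t₁ t₂ t₃ t₄ i → t ∈ Set.Icc (0 : ℝ) 1 →
      arc (planarEdge i) s = arc f t → planarEdge i = f := by
    intro i s f t hs ht hst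
    by_contra hne
    have hJi := hJ i s hs
    rcases hmeet _ _ hne s (hJI i s hs) t ht hst with ⟨v, ⟨-, h⟩ | ⟨-, h⟩, -⟩ | ⟨he, -, rfl, -⟩
    · linarith [hJi.1]
    · linarith [hJi.2]
    · exact hcen' i he hs
  let B : V ⊕ X → Set (ℝ × ℝ)
    | Sum.inl v => (⋃ e, ⋃ (_ : src e = v), arc e '' Set.Icc 0 (t₁ e)) ∪
        ⋃ e, ⋃ (_ : tgt e = v), arc e '' Set.Icc (t₄ e) 1
    | Sum.inr x => ⋃ e, ⋃ (_ : xp e = x), arc e.1 '' Set.Icc (t₂ e.1) (t₃ e.1)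
  have hB : ∀ w q, q ∈ B w ↔ ∃ e s, vertexPiece src tgt t₁ t₂ t₃ t₄ xp e w s ∧ arc e s = q := by
    intro w q
    rcases w with v | x
    · simp only [B, vertexPiece, Set.mem_union, Set.mem_iUnion, Set.mem_image]
      constructor
      · rintro (⟨e, h, s, hs, rfl⟩ | ⟨e, h, s, hs, rfl⟩)
        · exact ⟨e, s, Or.inl ⟨h, hs⟩, rfl⟩
        · exact ⟨e, s, Or.inr ⟨h, hs⟩, rfl⟩
      · rintro ⟨e, s, ⟨h, hs⟩ | ⟨h, hs⟩, rfl⟩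
        · exact Or.inl ⟨e, h, s, hs, rfl⟩
        · exact Or.inr ⟨e, h, s, hs, rfl⟩
    · simp only [B, vertexPiece, Set.mem_iUnion, Set.mem_image]
      constructor
      · rintro ⟨e, h, s, hs, rfl⟩
        exact ⟨e, s, ⟨e.2, h, hs⟩, rfl⟩
      · rintro ⟨e, s, ⟨h, h', hs⟩, rfl⟩
        exact ⟨⟨e, h⟩, h', s, hs, rfl⟩
  have hsub₁ : ∀ e, Set.Icc 0 (t₁ e) ⊆ Set.Icc (0 : ℝ) 1 := fun e =>
    Set.Icc_subset_Icc le_rfl (by linarith [ht₁ e, ht₂ e, ht₃ e, ht₄ e, ht₅ e])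
  have hsub₂ : ∀ e, Set.Icc (t₂ e) (t₃ e) ⊆ Set.Icc (0 : ℝ) 1 := fun e =>
    Set.Icc_subset_Icc (by linarith [ht₀ e, ht₁ e]) (by linarith [ht₄ e, ht₅ e])
  have hsub₄ : ∀ e, Set.Icc (t₄ e) 1 ⊆ Set.Icc (0 : ℝ) 1 := fun e =>
    Set.Icc_subset_Icc (by linarith [ht₀ e, ht₁ e, ht₂ e, ht₃ e, ht₄ e]) le_rfl
  have hBc : ∀ w, IsCompact (B w) := by
    rintro (v | x)
    · refine IsCompact.union (isCompact_iUnion fun e => isCompact_iUnion fun _ => ?_)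
        (isCompact_iUnion fun e => isCompact_iUnion fun _ => ?_)
      · exact isCompact_Icc.image_of_continuousOn ((hc e).mono (hsub₁ e))
      · exact isCompact_Icc.image_of_continuousOn ((hc e).mono (hsub₄ e))
    · refine isCompact_iUnion fun e => isCompact_iUnion fun _ => ?_
      exact isCompact_Icc.image_of_continuousOn ((hc e).mono (hsub₂ e))
  have hBp : ∀ w, IsPreconnected (B w) := by
    rintro (v | x)
    · refine isPreconnected_of_forall (pos v) fun q hq => ?_
      rcases hq with hq | hq
      · simp only [Set.mem_iUnion] at hq
        obtain ⟨e, he, hq⟩ := hq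
        refine ⟨arc e '' Set.Icc 0 (t₁ e), ?_, ⟨0, ⟨le_rfl, (ht₀ e).le⟩, by rw [h₀, he]⟩, hq,
          isPreconnected_Icc.image _ ((hc e).mono (hsub₁ e))⟩
        exact fun y hy => Or.inl (Set.mem_iUnion₂.2 ⟨e, he, hy⟩)
      · simp only [Set.mem_iUnion] at hq
        obtain ⟨e, he, hq⟩ := hq
        refine ⟨arc e '' Set.Icc (t₄ e) 1, ?_, ⟨1, ⟨(ht₅ e).le, le_rfl⟩, by rw [h₁, he]⟩, hq,
          isPreconnected_Icc.image _ ((hc e).mono (hsub₄ e))⟩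
        exact fun y hy => Or.inr (Set.mem_iUnion₂.2 ⟨e, he, hy⟩)
    · refine isPreconnected_of_forall (p x) fun q hq => ?_
      simp only [B, Set.mem_iUnion] at hq
      obtain ⟨e, he, hq⟩ := hq
      refine ⟨arc e '' Set.Icc (t₂ e) (t₃ e), ?_, ⟨c e, ⟨(ht₂ e).le, (ht₃ e).le⟩, by rw [hp, he]⟩, hq,
        isPreconnected_Icc.image _ ((hc e).mono (hsub₂ e))⟩
      exact fun y hy => Set.mem_iUnion₂.2 ⟨e, he, hy⟩
  have h₂₃ : ∀ e, t₂ e < t₃ e := fun e => (ht₂ e).trans (ht₃ e)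
  have h₁₄ : ∀ e, t₁ e < t₄ e := fun e => (ht₁ e).trans ((h₂₃ e).trans (ht₄ e))
  have hB₁ : ∀ e, arc e (t₁ e) ∈ B (Sum.inl (src e)) := fun e =>
    (hB (Sum.inl (src e)) _).2 ⟨e, t₁ e, Or.inl ⟨rfl, (ht₀ e).le, le_rfl⟩, rfl⟩
  have hB₄ : ∀ e, arc e (t₄ e) ∈ B (Sum.inl (tgt e)) := fun e =>
    (hB (Sum.inl (tgt e)) _).2 ⟨e, t₄ e, Or.inr ⟨rfl, le_rfl, (ht₅ e).le⟩, rfl⟩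
  have hcM : ∀ i, ContinuousOn (arc (planarEdge i)) (edgePiece (C := C) t₁ t₂ t₃ t₄ i) :=
    fun i => (hc _).mono fun s => hJI i s
  refine exists_isAlgDual_of_drawing _ _ ?_ B
    (fun i => arc (planarEdge i) '' edgePiece t₁ t₂ t₃ t₄ i) hBc hBp ?_ ?_ ?_ ?_ ?_ ?_ ?_
  · rintro (e | ⟨e, _ | _⟩)
    · simpa [planarSrc, planarTgt] using hloop e
    · simp [planarTgt]
    · simp [planarTgt]
  · intro i
    refine IsCompact.image_of_continuousOn ?_ (hcM i)
    rcases i with e | ⟨e, _ | _⟩ <;> exact isCompact_Icc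
  · intro i
    refine IsPreconnected.image ?_ _ (hcM i)
    rcases i with e | ⟨e, _ | _⟩ <;> exact isPreconnected_Icc
  · intro u v huv
    rw [Set.disjoint_left]
    intro q hu hv
    obtain ⟨e, s, hs, rfl⟩ := (hB _ _).1 hu
    obtain ⟨f, t, ht, hst⟩ := (hB _ _).1 hv
    by_cases hef : e = f
    · subst hef
      obtain rfl := hi e (hI _ _ _ ht) (hI _ _ _ hs) hst
      have := ht₀ e; have := ht₁ e; have := ht₂ e; have := ht₃ e; have := ht₄ e; have := ht₅ e
      rcases u with u | u <;> rcases v with v | v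
      · rcases hs with ⟨rfl, hs, hs'⟩ | ⟨rfl, hs, hs'⟩ <;>
          rcases ht with ⟨rfl, ht, ht'⟩ | ⟨rfl, ht, ht'⟩
        · exact huv rfl
        · linarith
        · linarith
        · exact huv rfl
      · obtain ⟨-, -, ht, ht'⟩ := ht
        rcases hs with ⟨rfl, hs, hs'⟩ | ⟨rfl, hs, hs'⟩ <;> linarith
      · obtain ⟨-, -, hs, hs'⟩ := hs
        rcases ht with ⟨rfl, ht, ht'⟩ | ⟨rfl, ht, ht'⟩ <;> linarith
      · obtain ⟨_, rfl, -⟩ := hs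
        obtain ⟨_, rfl, -⟩ := ht
        exact huv rfl
    · rcases hmeet e f hef s (hI _ _ _ hs) t (hI _ _ _ ht) hst.symm with
        ⟨v, h, h'⟩ | ⟨he, hf, rfl, rfl, hx⟩
      · exact huv ((hzone _ _ _ _ h hs).trans (hzone _ _ _ _ h' ht).symm)
      · exact huv (by rw [hcen _ _ he hs, hcen _ _ hf ht, hx])
  · intro i j hij
    rw [Set.disjoint_left]
    rintro q ⟨s, hs, rfl⟩ ⟨t, ht, hst⟩
    have hij' := hnz i s _ t hs (hJI j t ht) hst.symm
    rw [hij'] at hst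
    obtain rfl := hi _ (hJI _ _ ht) (hJI _ _ hs) hst
    rcases i with e | ⟨e, β⟩ <;> rcases j with f | ⟨f, β'⟩
    · exact hij (congrArg _ (Subtype.ext hij'))
    · exact e.2 (by rw [show e.1 = f.1 from hij']; exact f.2)
    · exact f.2 (by rw [← show e.1 = f.1 from hij']; exact e.2)
    · obtain rfl : e = f := Subtype.ext hij'
      have := ht₂ e; have := ht₃ e
      rcases β with _ | _ <;> rcases β' with _ | _
      · exact hij rfl
      · linarith [hs.2, ht.1]
      · linarith [hs.1, ht.2]
      · exact hij rfl
  · intro i w hwa hwb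
    rw [Set.disjoint_left]
    rintro q ⟨s, hs, rfl⟩ hw
    obtain ⟨f, t, ht, hst⟩ := (hB _ _).1 hw
    obtain rfl := hnz i s _ t hs (hI _ _ _ ht) hst.symm
    obtain rfl := hi _ (hI _ _ _ ht) (hJI _ _ hs) hst
    rcases i with e | ⟨e, β⟩
    · rcases w with w | x
      · rcases ht with ⟨rfl, -⟩ | ⟨rfl, -⟩
        · exact hwa rfl
        · exact hwb rfl
      · exact e.2 ht.1
    · have := ht₁ e; have := ht₂ e; have := ht₃ e; have := ht₄ e
      rcases w with w | x
      · rcases β with _ | _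
        · rcases ht with ⟨rfl, -⟩ | ⟨rfl, ht, ht'⟩
          · exact hwa rfl
          · have h1 : t₄ e.1 ≤ t := ht
            linarith [hs.2]
        · rcases ht with ⟨rfl, ht, ht'⟩ | ⟨rfl, -⟩
          · have h1 : t ≤ t₁ e.1 := ht'
            linarith [hs.1]
          · exact hwa rfl
      · obtain ⟨_, rfl, -⟩ := ht
        exact hwb rfl
  · rintro (e | ⟨e, _ | _⟩)
    · exact ⟨_, ⟨_, ⟨le_rfl, (h₁₄ e).le⟩, rfl⟩, hB₁ e⟩
    · exact ⟨_, ⟨_, ⟨le_rfl, (ht₁ e).le⟩, rfl⟩, hB₁ e⟩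
    · exact ⟨_, ⟨_, ⟨(ht₄ e).le, le_rfl⟩, rfl⟩, hB₄ e⟩
  · rintro (e | ⟨e, _ | _⟩)
    · exact ⟨_, ⟨_, ⟨(h₁₄ e).le, le_rfl⟩, rfl⟩, hB₄ e⟩
    · exact ⟨_, ⟨_, ⟨(ht₁ e).le, le_rfl⟩, rfl⟩,
        (hB (Sum.inr (xp e)) _).2 ⟨e, t₂ e, ⟨e.2, rfl, le_rfl, (h₂₃ e).le⟩, rfl⟩⟩
    · exact ⟨_, ⟨_, ⟨le_rfl, (ht₄ e).le⟩, rfl⟩,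
        (hB (Sum.inr (xp e)) _).2 ⟨e, t₃ e, ⟨e.2, rfl, (h₂₃ e).le, le_rfl⟩, rfl⟩⟩

end

namespace OnePlanarDrawing
variable {V : Type*} {G : SimpleGraph V} (D : OnePlanarDrawing G)

theorem crossing_partner_unique {e f g : G.edgeSet} (hf : f ≠ e) (hg : g ≠ e) {s t s' t' : ℝ}
    (hs : s ∈ Set.Ioo (0 : ℝ) 1) (ht : t ∈ Set.Ioo (0 : ℝ) 1) (hs' : s' ∈ Set.Ioo (0 : ℝ) 1)
    (ht' : t' ∈ Set.Ioo (0 : ℝ) 1) (h : D.arc e s = D.arc f t) (h' : D.arc e s' = D.arc g t') :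
    f = g :=
  D.at_most_one_crossing e ⟨hf, _, ⟨s, hs, rfl⟩, t, ht, h.symm⟩
    ⟨hg, _, ⟨s', hs', rfl⟩, t', ht', h'.symm⟩

theorem crossing_time_unique {e f g : G.edgeSet} (hf : f ≠ e) (hg : g ≠ e) {s t s' t' : ℝ}
    (hs : s ∈ Set.Ioo (0 : ℝ) 1) (ht : t ∈ Set.Ioo (0 : ℝ) 1) (hs' : s' ∈ Set.Ioo (0 : ℝ) 1)
    (ht' : t' ∈ Set.Ioo (0 : ℝ) 1) (h : D.arc e s = D.arc f t) (h' : D.arc e s' = D.arc g t') :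
    s = s' := by
  obtain rfl := D.crossing_partner_unique hf hg hs ht hs' ht' h h'
  exact D.arc_inj e (Set.Ioo_subset_Icc_self hs) (Set.Ioo_subset_Icc_self hs')
    (D.crossings_subsingleton e f hf.symm ⟨⟨s, hs, rfl⟩, t, ht, h.symm⟩
      ⟨⟨s', hs', rfl⟩, t', ht', h'.symm⟩)

/-- Each arc can be cut so that a crossing with an adjacent edge lies in the outer piece at the
common vertex, and a crossing with a nonadjacent edge is the prescribed middle point. -/
theorem exists_times {e : G.edgeSet} {u v : V} (he : (e : Sym2 V) = s(u, v)) (huv : u ≠ v) :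
    ∃ t₁ t₂ c t₃ t₄ : ℝ, 0 < t₁ ∧ t₁ < t₂ ∧ t₂ < c ∧ c < t₃ ∧ t₃ < t₄ ∧ t₄ < 1 ∧
      ∀ f ≠ e, ∀ s ∈ Set.Ioo (0 : ℝ) 1, ∀ t ∈ Set.Ioo (0 : ℝ) 1, D.arc e s = D.arc f t →
        (u ∈ (f : Sym2 V) → s < t₁) ∧ (v ∈ (f : Sym2 V) → t₄ < s) ∧
          (u ∉ (f : Sym2 V) → v ∉ (f : Sym2 V) → s = c) := by
  by_cases h : ∃ f, f ≠ e ∧ ∃ s ∈ Set.Ioo (0 : ℝ) 1, ∃ t ∈ Set.Ioo (0 : ℝ) 1,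
    D.arc e s = D.arc f t
  · obtain ⟨f, hfe, s, hs, t, ht, hst⟩ := h
    have huniq : ∀ g ≠ e, ∀ s' ∈ Set.Ioo (0 : ℝ) 1, ∀ t' ∈ Set.Ioo (0 : ℝ) 1,
        D.arc e s' = D.arc g t' → g = f ∧ s' = s := fun g hg s' hs' t' ht' h =>
      ⟨D.crossing_partner_unique hg hfe hs' ht' hs ht h hst,
        D.crossing_time_unique hg hfe hs' ht' hs ht h hst⟩
    obtain ⟨hs0, hs1⟩ := hs
    have hnot : ¬ (u ∈ (f : Sym2 V) ∧ v ∈ (f : Sym2 V)) := fun h =>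
      hfe (Subtype.ext (((Sym2.mem_and_mem_iff huv).1 h).trans he.symm))
    by_cases hu : u ∈ (f : Sym2 V)
    · refine ⟨s + (1 - s) / 6, s + (1 - s) * 2 / 6, s + (1 - s) * 3 / 6, s + (1 - s) * 4 / 6,
        s + (1 - s) * 5 / 6, by linarith, by linarith, by linarith, by linarith, by linarith,
        by linarith, fun g hg s' hs' t' ht' h => ?_⟩
      obtain ⟨rfl, rfl⟩ := huniq g hg s' hs' t' ht' h
      exact ⟨fun _ => by linarith, fun hv => absurd ⟨hu, hv⟩ hnot, fun h => absurd hu h⟩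
    by_cases hv : v ∈ (f : Sym2 V)
    · refine ⟨s / 6, s * 2 / 6, s * 3 / 6, s * 4 / 6, s * 5 / 6, by linarith, by linarith,
        by linarith, by linarith, by linarith, by linarith, fun g hg s' hs' t' ht' h => ?_⟩
      obtain ⟨rfl, rfl⟩ := huniq g hg s' hs' t' ht' h
      exact ⟨fun h => absurd h hu, fun _ => by linarith, fun _ h => absurd hv h⟩
    · refine ⟨s / 3, s * 2 / 3, s, s + (1 - s) / 3, s + (1 - s) * 2 / 3, by linarith,
        by linarith, by linarith, by linarith, by linarith, by linarith,
        fun g hg s' hs' t' ht' h => ?_⟩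
      obtain ⟨rfl, rfl⟩ := huniq g hg s' hs' t' ht' h
      exact ⟨fun h => absurd h hu, fun h => absurd h hv, fun _ _ => rfl⟩
  · refine ⟨1 / 6, 2 / 6, 3 / 6, 4 / 6, 5 / 6, by norm_num, by norm_num, by norm_num,
      by norm_num, by norm_num, by norm_num, fun f hf s hs t ht hst => ?_⟩
    exact absurd ⟨f, hf, s, hs, t, ht, hst⟩ h

/-- An arc can pass through the position of a vertex only at an end. -/
theorem end_of_arc_eq_pos {e : G.edgeSet} {u v : V} (h₀ : D.arc e 0 = D.pos u)
    (h₁ : D.arc e 1 = D.pos v) {s : ℝ} (hs : s ∈ Set.Icc (0 : ℝ) 1) {w : V}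
    (h : D.arc e s = D.pos w) : (u = w ∧ s = 0) ∨ (v = w ∧ s = 1) := by
  rcases hs.1.eq_or_lt with rfl | hs0
  · exact Or.inl ⟨D.pos_inj (h₀.symm.trans h), rfl⟩
  rcases hs.2.eq_or_lt with rfl | hs1
  · exact Or.inr ⟨D.pos_inj (h₁.symm.trans h), rfl⟩
  · exact absurd ⟨w, h.symm⟩ (D.arc_avoids e s ⟨hs0, hs1⟩)

end OnePlanarDrawing

theorem leftDegree_add_rightDegree_planar {V X : Type*} [Fintype V] {G : SimpleGraph V}
    [DecidableRel G.Adj] [Fintype G.edgeSet] {C : G.edgeSet → Prop} [DecidablePred C]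
    {src tgt : G.edgeSet → V} (he : ∀ e : G.edgeSet, (e : Sym2 V) = s(src e, tgt e))
    (hne : ∀ e, src e ≠ tgt e) (xp : {e // C e} → X) (v : V) :
    leftDegree (planarSrc src tgt) (planarTgt tgt xp) v +
      rightDegree (planarSrc src tgt) (planarTgt tgt xp) v = G.degree v := by
  classical
  rw [leftDegree, rightDegree, ← Finset.card_union_of_disjoint, ← Finset.filter_or,
    ← G.card_incidenceFinset_eq_degree]
  · refine Finset.card_bij (fun i _ => ((planarEdge i : G.edgeSet) : Sym2 V)) ?_ ?_ ?_
    · intro i hi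
      rw [Finset.mem_filter] at hi
      rw [SimpleGraph.mem_incidenceFinset]
      refine ⟨(planarEdge i).2, ?_⟩
      rw [he]
      rcases i with e | ⟨e, _ | _⟩
      · simpa [planarSrc, planarTgt, planarEdge, eq_comm] using hi
      · exact Sym2.mem_iff.2 (Or.inl (by simpa [planarSrc, planarTgt, planarEdge, eq_comm] using hi))
      · exact Sym2.mem_iff.2 (Or.inr (by simpa [planarSrc, planarTgt, planarEdge, eq_comm] using hi))
    · intro i hi j hj hij
      rw [Finset.mem_filter] at hi hj
      have hij := Subtype.ext hij
      rcases i with e | ⟨e, β⟩ <;> rcases j with f | ⟨f, β'⟩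
      · exact congrArg _ (Subtype.ext hij)
      · exact absurd f.2 (by rw [← show e.1 = f.1 from hij]; exact e.2)
      · exact absurd e.2 (by rw [show e.1 = f.1 from hij]; exact f.2)
      · obtain rfl : e = f := Subtype.ext hij
        have := hne e
        rcases β with _ | _ <;> rcases β' with _ | _ <;>
          simp [planarSrc, planarTgt] at hi hj ⊢
        · exact this (hi.trans hj.symm)
        · exact this (hj.trans hi.symm)
    · intro e hev
      rw [SimpleGraph.mem_incidenceFinset] at hev
      obtain ⟨heG, hv⟩ := hev
      have hv' : v = src ⟨e, heG⟩ ∨ v = tgt ⟨e, heG⟩ := by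
        rw [← Sym2.mem_iff, ← he]
        exact hv
      by_cases hC : C ⟨e, heG⟩
      · rcases hv' with hv' | hv'
        · exact ⟨Sum.inr (⟨_, hC⟩, false), by simp [planarSrc, planarTgt, hv'], rfl⟩
        · exact ⟨Sum.inr (⟨_, hC⟩, true), by simp [planarSrc, planarTgt, hv'], rfl⟩
      · exact ⟨Sum.inl ⟨_, hC⟩, by
          simpa [planarSrc, planarTgt, eq_comm (b := v)] using hv', rfl⟩
  · rw [Finset.disjoint_filter]
    intro i _ h h'
    have := h'.1
    rw [← Sum.not_isLeft, h.1] at this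
    exact absurd this (by simp)

/-- The edge bound for 1-planar graphs with enough edges, sharpened by the number of vertices of
odd degree. -/
theorem OnePlanarDrawing.edge_bound {V : Type*} [Fintype V] [Nonempty V] {G : SimpleGraph V}
    [DecidableRel G.Adj] (D : OnePlanarDrawing G)
    (hV : 2 * Fintype.card V ≤ ∑ v, G.degree v) :
    3 * ∑ v, G.degree v + 48 + ∑ v, G.degree v % 2 ≤ 24 * Fintype.card V := by
  classical
  choose src tgt he h₀ h₁ using D.arc_ends
  have hne : ∀ e, src e ≠ tgt e := by
    intro e h
    have := e.2
    rw [he e, h] at this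
    exact G.loopless.irrefl _ this
  have hadj : ∀ e f, src e = src f → tgt e = tgt f → e = f := fun e f h h' =>
    Subtype.ext (by rw [he e, he f, h, h'])
  have hadj' : ∀ e f, src e = tgt f → tgt e = src f → e = f := fun e f h h' =>
    Subtype.ext (by rw [he e, he f, h, h', Sym2.eq_swap])
  have hsrc : ∀ e : G.edgeSet, src e ∈ (e : Sym2 V) := fun e =>
    (he e).symm ▸ Sym2.mem_mk_left _ _
  have htgt : ∀ e : G.edgeSet, tgt e ∈ (e : Sym2 V) := fun e =>
    (he e).symm ▸ Sym2.mem_mk_right _ _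
  have hmem : ∀ (e : G.edgeSet) w, w ∈ (e : Sym2 V) → src e = w ∨ tgt e = w := fun e w h => by
    rw [he e, Sym2.mem_iff] at h
    exact h.imp Eq.symm Eq.symm
  choose t₁ t₂ c t₃ t₄ ht₀ ht₁ ht₂ ht₃ ht₄ ht₅ htimes using
    fun e => D.exists_times (he e) (hne e)
  have hcI : ∀ e, c e ∈ Set.Ioo (0 : ℝ) 1 := fun e =>
    ⟨by linarith [ht₀ e, ht₁ e, ht₂ e], by linarith [ht₃ e, ht₄ e, ht₅ e]⟩
  let C : G.edgeSet → Prop := fun e => ∃ f, f ≠ e ∧ D.arc e (c e) = D.arc f (c f) ∧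
    ∀ v ∈ (e : Sym2 V), v ∉ (f : Sym2 V)
  let xp : {e // C e} → Set.range fun e : {e // C e} => D.arc e (c e) :=
    fun e => ⟨D.arc e (c e), e, rfl⟩
  have hxp : ∀ e f : {e // C e}, e ≠ f → xp e = xp f →
      ∀ v ∈ (e.1 : Sym2 V), v ∉ (f.1 : Sym2 V) := by
    intro e f hef h
    obtain ⟨g, hg, hgc, hgv⟩ := e.2
    have hfe : f.1 ≠ e.1 := fun h => hef (Subtype.ext h.symm)
    rwa [D.crossing_partner_unique hfe hg (hcI _) (hcI _) (hcI _) (hcI _)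
      (congrArg Subtype.val h) hgc]
  have hmeet : ∀ e f, e ≠ f → ∀ s ∈ Set.Icc (0 : ℝ) 1, ∀ t ∈ Set.Icc (0 : ℝ) 1,
      D.arc e s = D.arc f t →
      (∃ v, ((src e = v ∧ s < t₁ e) ∨ (tgt e = v ∧ t₄ e < s)) ∧
        ((src f = v ∧ t < t₁ f) ∨ (tgt f = v ∧ t₄ f < t))) ∨
      ∃ (he : C e) (hf : C f), s = c e ∧ t = c f ∧ xp ⟨e, he⟩ = xp ⟨f, hf⟩ := by
    have hzone : ∀ e s v, s ∈ Set.Icc (0 : ℝ) 1 → D.arc e s = D.pos v →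
        (src e = v ∧ s < t₁ e) ∨ (tgt e = v ∧ t₄ e < s) := by
      intro e s v hs h
      rcases D.end_of_arc_eq_pos (h₀ e) (h₁ e) hs h with ⟨rfl, rfl⟩ | ⟨rfl, rfl⟩
      · exact Or.inl ⟨rfl, ht₀ e⟩
      · exact Or.inr ⟨rfl, ht₅ e⟩
    intro e f hef s hs t ht hst
    by_cases hv : ∃ v, D.arc e s = D.pos v
    · obtain ⟨v, hv⟩ := hv
      exact Or.inl ⟨v, hzone e s v hs hv, hzone f t v ht (hst.symm.trans hv)⟩
    have hs' : s ∈ Set.Ioo (0 : ℝ) 1 :=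
      ⟨hs.1.lt_of_ne (by rintro rfl; exact hv ⟨_, h₀ e⟩),
        hs.2.lt_of_ne (by rintro rfl; exact hv ⟨_, h₁ e⟩)⟩
    have ht' : t ∈ Set.Ioo (0 : ℝ) 1 :=
      ⟨ht.1.lt_of_ne (by rintro rfl; exact hv ⟨_, hst.trans (h₀ f)⟩),
        ht.2.lt_of_ne (by rintro rfl; exact hv ⟨_, hst.trans (h₁ f)⟩)⟩
    obtain ⟨h1, h2, h3⟩ := htimes e f hef.symm s hs' t ht' hst
    obtain ⟨h4, h5, h6⟩ := htimes f e hef t ht' s hs' hst.symm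
    by_cases hcom : ∃ v, v ∈ (e : Sym2 V) ∧ v ∈ (f : Sym2 V)
    · obtain ⟨v, hve, hvf⟩ := hcom
      refine Or.inl ⟨v, ?_, ?_⟩
      · exact (hmem e v hve).imp (fun h => ⟨h, h1 (h ▸ hvf)⟩) (fun h => ⟨h, h2 (h ▸ hvf)⟩)
      · exact (hmem f v hvf).imp (fun h => ⟨h, h4 (h ▸ hve)⟩) (fun h => ⟨h, h5 (h ▸ hve)⟩)
    · push Not at hcom
      obtain rfl := h3 (hcom _ (hsrc e)) (hcom _ (htgt e))
      obtain rfl := h6 (fun h => hcom _ h (hsrc f)) (fun h => hcom _ h (htgt f))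
      exact Or.inr ⟨⟨f, hef.symm, hst, hcom⟩,
        ⟨e, hef, hst.symm, fun v hv hv' => hcom v hv' hv⟩, rfl, rfl, Subtype.ext hst⟩
  obtain ⟨F, l, r, hdual⟩ := exists_isAlgDual_of_arcs src tgt D.arc D.arc_cont D.arc_inj D.pos
    h₀ h₁ hne t₁ t₂ c t₃ t₄ ht₀ ht₁ ht₂ ht₃ ht₄ ht₅ xp Subtype.val (fun _ => rfl) hmeet
  have hX : Fintype.card (Set.range fun e : {e // C e} => D.arc e (c e)) * 2 ≤
      Fintype.card {e // C e} := by
    rw [mul_comm, ← Finset.card_univ, ← Finset.card_univ]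
    refine Finset.mul_card_image_le_card_of_maps_to (f := xp) (fun _ _ => Finset.mem_univ _) 2 ?_
    rintro ⟨_, e, rfl⟩ -
    obtain ⟨f, hfe, hef, hv⟩ := e.2
    refine Finset.one_lt_card.2 ⟨e, by simp [xp], ⟨f, e, hfe.symm, hef.symm,
      fun v h h' => hv v h' h⟩, by simp [xp, hef], fun h => hfe (congrArg Subtype.val h).symm⟩
  have hE : Fintype.card ({e // ¬ C e} ⊕ {e // C e} × Bool) =
      G.edgeFinset.card + Fintype.card {e // C e} := by
    have := Fintype.card_subtype_compl C
    have := Fintype.card_subtype_le C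
    rw [Fintype.card_sum, Fintype.card_prod, Fintype.card_bool, SimpleGraph.edgeFinset_card]
    omega
  have hsum := G.sum_degrees_eq_twice_card_edges
  have hbound := hdual.edge_bound ?_ ?_ ?_ (by omega)
  · simp only [leftDegree_add_rightDegree_planar he hne xp] at hbound
    convert_to 3 * ∑ v, G.degree v + 48 + ∑ v, G.degree v % 2 ≤ 24 * Fintype.card V
    rw [hE] at hbound
    omega
  · rintro (e | ⟨e, β⟩)
    · simpa [planarSrc, planarTgt] using (hne e).symm
    · simp [planarTgt]
  · rintro (e | ⟨e, β⟩) (f | ⟨f, β'⟩) hef ha hb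
    · simp only [planarSrc, planarTgt, Sum.inl.injEq] at ha hb
      exact hef (congrArg _ (Subtype.ext (hadj _ _ ha hb)))
    · simp [planarTgt] at hb
    · simp [planarTgt] at hb
    · simp only [planarTgt, Sum.inr.injEq] at hb
      by_cases h : e = f
      · subst h
        have := hne e
        rcases β with _ | _ <;> rcases β' with _ | _
        · exact hef rfl
        · exact this ha
        · exact this ha.symm
        · exact hef rfl
      · have hmem' : ∀ (e : {e // C e}) β, planarSrc src tgt (Sum.inr (e, β)) ∈ (e.1 : Sym2 V) := by
          rintro e (_ | _)
          · exact hsrc e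
          · exact htgt e
        exact hxp e f h hb _ (hmem' e β) (ha ▸ hmem' f β')
  · rintro (e | ⟨e, β⟩) (f | ⟨f, β'⟩) hef hb hb'
    · simp only [planarSrc, planarTgt, Sum.inl.injEq] at hb hb'
      exact hef (congrArg _ (Subtype.ext (hadj' _ _ hb'.symm hb)))
    all_goals simp [planarTgt] at hb hb'

theorem SimpleGraph.sum_sum_neighborFinset {V : Type*} [Fintype V] (G : SimpleGraph V)
    [DecidableRel G.Adj] (ρ : V → ℕ) :
    ∑ v, ∑ u ∈ G.neighborFinset v, ρ u = ∑ u, G.degree u * ρ u := by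
  simp only [SimpleGraph.neighborFinset_eq_filter, Finset.sum_filter]
  rw [Finset.sum_comm]
  refine Finset.sum_congr rfl fun u _ => ?_
  simp only [G.adj_comm _ u, ← Finset.sum_filter, Finset.sum_const, smul_eq_mul,
    ← SimpleGraph.neighborFinset_eq_filter, SimpleGraph.card_neighborFinset_eq_degree]

/-- Every 1-planar graph with minimum degree 7 contains a copy of K_{1,7}
whose center has degree exactly 7, whose leaves all have degree at most 23,
and at most one of whose leaves has degree at least 12. -/
theorem one_planar_light_star {V : Type*} [Fintype V] [Nonempty V]
    (G : SimpleGraph V) [DecidableRel G.Adj] (h1p : G.IsOnePlanar)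
    (hmin : ∀ v : V, 7 ≤ G.degree v) :
    ∃ (c : V) (f : Fin 7 → V), Function.Injective f ∧
      (∀ i : Fin 7, G.Adj c (f i)) ∧
      G.degree c = 7 ∧
      (∀ i : Fin 7, G.degree (f i) ≤ 23) ∧
      (∀ i j : Fin 7, 12 ≤ G.degree (f i) → 12 ≤ G.degree (f j) → i = j) := by
  classical
  by_contra hno
  obtain ⟨D⟩ := h1p
  let ρ : V → ℕ := fun v => if 24 ≤ G.degree v then 2 else if 12 ≤ G.degree v then 1 else 0
  have hρ₁ : ∀ v, 12 ≤ G.degree v → 1 ≤ ρ v := fun v h => by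
    simp only [ρ]
    split_ifs <;> simp
  have hstar : ∀ v, G.degree v = 7 → 2 ≤ ∑ u ∈ G.neighborFinset v, ρ u := by
    intro v hv
    by_contra! hlt
    let g := (G.neighborFinset v).equivFinOfCardEq ((G.card_neighborFinset_eq_degree v).trans hv)
    have hg : ∀ i, (g.symm i : V) ∈ G.neighborFinset v := fun i => (g.symm i).2
    refine hno ⟨v, fun i => g.symm i, Subtype.val_injective.comp g.symm.injective,
      fun i => (G.mem_neighborFinset v _).1 (hg i), hv, fun i => ?_, fun i j hi hj => ?_⟩
    · by_contra! h
      have h2 : ρ (g.symm i) = 2 := if_pos h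
      have := Finset.single_le_sum (f := ρ) (fun _ _ => Nat.zero_le _) (hg i)
      omega
    · by_contra hij
      have hne : (g.symm i : V) ≠ g.symm j := fun h =>
        hij (g.symm.injective (Subtype.val_injective h))
      have hsub := Finset.sum_le_sum_of_subset (f := ρ)
        (Finset.insert_subset (hg i) (Finset.singleton_subset_iff.2 (hg j)))
      rw [Finset.sum_pair hne] at hsub
      have := hρ₁ (g.symm i) hi
      have := hρ₁ (g.symm j) hj
      omega
  have hpoint : ∀ v, 24 + G.degree v * ρ v ≤
      3 * G.degree v + G.degree v % 2 + ∑ u ∈ G.neighborFinset v, ρ u := by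
    intro v
    rcases (hmin v).eq_or_lt with h | h
    · have := hstar v h.symm
      simp only [ρ, ← h] at this ⊢
      norm_num
      omega
    · simp only [ρ]
      split_ifs <;> omega
  have hsum := Finset.sum_le_sum fun v (_ : v ∈ Finset.univ) => hpoint v
  simp only [Finset.sum_add_distrib, ← Finset.mul_sum, G.sum_sum_neighborFinset] at hsum
  have hmin' := Finset.sum_le_sum fun v (_ : v ∈ Finset.univ) => hmin v
  simp only [Finset.sum_const, Finset.card_univ, smul_eq_mul] at hsum hmin'
  have := D.edge_bound (by omega)
  omega
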